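/- arXiv:1203.4200 — 7 statements merged into one kernel-verified Lean document; each statement's English description precedes it below -/
import Mathlib

section
/- Let f = Σ_{ℓ=0}^{d} α_ℓ/(x-(β+ℓ))^s with α_ℓ, β in an algebraically closed field of characteristic zero and s ≥ 1. Then f is rational summable (i.e., f = g(x+1) - g(x) for some rational function g) if and only if Σ_{ℓ=0}^{d} α_ℓ = 0. -/
open Polynomial

section RationalSummability

variable {L : Type*} [Field L]

/-- `g` has no pole at `a`. -/
def RatFunc.RegularAt (g : RatFunc L) (a : L) : Prop :=
  ∃ p q : L[X], q.eval a ≠ 0 ∧ g * algebraMap L[X] (RatFunc L) q = algebraMap L[X] (RatFunc L) p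

namespace RatFunc

theorem RegularAt.add {g h : RatFunc L} {a : L} (hg : g.RegularAt a) (hh : h.RegularAt a) :
    (g + h).RegularAt a := by
  obtain ⟨p, q, hq, hpq⟩ := hg
  obtain ⟨p', q', hq', hpq'⟩ := hh
  refine ⟨p * q' + p' * q, q * q', by simp [hq, hq'], ?_⟩
  simp only [map_add, map_mul, ← hpq, ← hpq']
  ring

theorem RegularAt.neg {g : RatFunc L} {a : L} (hg : g.RegularAt a) : (-g).RegularAt a := by
  obtain ⟨p, q, hq, hpq⟩ := hg
  exact ⟨-p, q, hq, by rw [map_neg, ← hpq, neg_mul]⟩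

theorem RegularAt.sub {g h : RatFunc L} {a : L} (hg : g.RegularAt a) (hh : h.RegularAt a) :
    (g - h).RegularAt a :=
  sub_eq_add_neg g h ▸ hg.add hh.neg

theorem X_sub_C_ne_zero (b : L) : (X - C b : RatFunc L) ≠ 0 := by
  rw [← algebraMap_X, ← algebraMap_C, ← map_sub]
  exact algebraMap_ne_zero (Polynomial.X_sub_C_ne_zero b)

theorem regularAt_C_div_X_sub_C_pow (c : L) {a b : L} (hab : a ≠ b) (s : ℕ) :
    (C c / (X - C b) ^ s).RegularAt a := by
  refine ⟨Polynomial.C c, (Polynomial.X - Polynomial.C b) ^ s, ?_, ?_⟩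
  · simpa using pow_ne_zero s (sub_ne_zero.mpr hab)
  · simp only [map_pow, map_sub, algebraMap_X, algebraMap_C]
    exact div_mul_cancel₀ _ (pow_ne_zero s (X_sub_C_ne_zero b))

theorem eq_zero_of_regularAt_C_div_X_sub_C_pow {c b : L} {s : ℕ} (hs : s ≠ 0)
    (h : (C c / (X - C b) ^ s).RegularAt b) : c = 0 := by
  obtain ⟨p, q, hq, hpq⟩ := h
  rw [div_mul_eq_mul_div, div_eq_iff (pow_ne_zero s (X_sub_C_ne_zero b)), ← algebraMap_X,
    ← algebraMap_C, ← algebraMap_C, ← map_sub, ← map_pow, ← map_mul, ← map_mul] at hpq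
  have := congrArg (Polynomial.eval b) (algebraMap_injective L hpq)
  simpa [hs, hq] using this

/-- A rational function is regular at some point of every injective sequence. -/
theorem exists_regularAt (g : RatFunc L) {u : ℕ → L} (hu : Function.Injective u) :
    ∃ n, g.RegularAt (u n) := by
  by_contra! h
  refine g.denom_ne_zero (Polynomial.eq_zero_of_infinite_isRoot _
    ((Set.infinite_range_of_injective hu).mono ?_))
  rintro _ ⟨n, rfl⟩
  by_contra hn
  refine h n ⟨g.num, g.denom, hn, ?_⟩
  exact ((div_eq_iff (algebraMap_ne_zero g.denom_ne_zero)).mp (num_div_denom g)).symm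

section Shift

variable {τ : RatFunc L →+* RatFunc L}

theorem shift_algebraMap (hτC : ∀ a, τ (C a) = C a) (hτX : τ X = X + 1)
    (p : L[X]) :
    τ (algebraMap L[X] (RatFunc L) p) =
      algebraMap L[X] (RatFunc L) (p.comp (Polynomial.X + 1)) := by
  induction p using Polynomial.induction_on' with
  | add p q hp hq => simp only [map_add, hp, hq, Polynomial.add_comp]
  | monomial n a =>
    simp only [← Polynomial.C_mul_X_pow_eq_monomial, map_mul, map_pow, algebraMap_X,
      algebraMap_C, hτC, hτX, Polynomial.mul_comp, Polynomial.C_comp, Polynomial.X_pow_comp,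
      map_add, map_one]

theorem regularAt_shift_iff (hτC : ∀ a, τ (C a) = C a) (hτX : τ X = X + 1)
    (g : RatFunc L) (a : L) :
    (τ g).RegularAt a ↔ g.RegularAt (a + 1) := by
  constructor
  · rintro ⟨p, q, hq, hpq⟩
    refine ⟨p.comp (Polynomial.X - 1), q.comp (Polynomial.X - 1), by simpa using hq,
      τ.injective ?_⟩
    rw [map_mul, shift_algebraMap hτC hτX, shift_algebraMap hτC hτX]
    simpa [Polynomial.comp_assoc] using hpq
  · rintro ⟨p, q, hq, hpq⟩
    refine ⟨p.comp (Polynomial.X + 1), q.comp (Polynomial.X + 1), by simpa using hq, ?_⟩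
    rw [← shift_algebraMap hτC hτX, ← shift_algebraMap hτC hτX, ← map_mul, hpq]

theorem shift_C_div_X_sub_C_pow (hτC : ∀ a, τ (C a) = C a) (hτX : τ X = X + 1)
    (c b : L) (s : ℕ) :
    τ (C c / (X - C (b + 1)) ^ s) = C c / (X - C b) ^ s := by
  simp only [map_div₀, map_pow, map_sub, hτC, hτX, map_add, map_one, add_sub_add_right_eq_sub]

/-- Simple fractions whose poles differ by an integer agree up to a summable function. -/
theorem exists_C_div_X_sub_C_pow_eq (hτC : ∀ a, τ (C a) = C a) (hτX : τ X = X + 1)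
    (c b : L) (s n : ℕ) :
    ∃ h, C c / (X - C (b + (n : L))) ^ s = C c / (X - C b) ^ s + (τ h - h) := by
  induction n with
  | zero => exact ⟨0, by simp⟩
  | succ n ih =>
    obtain ⟨h, hh⟩ := ih
    refine ⟨h - C c / (X - C (b + (n : L) + 1)) ^ s, ?_⟩
    rw [map_sub, shift_C_div_X_sub_C_pow hτC hτX, hh, Nat.cast_succ, ← add_assoc]
    ring

theorem eq_zero_of_C_div_X_sub_C_pow_eq_shift_sub [CharZero L]
    (hτC : ∀ a, τ (C a) = C a) (hτX : τ X = X + 1) {c b : L} {s : ℕ} (hs : s ≠ 0)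
    {g : RatFunc L} (h : C c / (X - C b) ^ s = τ g - g) : c = 0 := by
  have hstep (a : L) (hab : a ≠ b) : g.RegularAt (a + 1) ↔ g.RegularAt a := by
    have hreg := regularAt_C_div_X_sub_C_pow c hab s
    rw [h] at hreg
    rw [← regularAt_shift_iff hτC hτX]
    exact ⟨fun H ↦ by simpa using H.sub hreg, fun H ↦ by simpa using hreg.add H⟩
  have hright : g.RegularAt (b + 1) := by
    obtain ⟨n, hn⟩ := g.exists_regularAt (u := fun n : ℕ ↦ b + (n : L) + 1)
      fun m n hmn ↦ by simpa using hmn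
    induction n with
    | zero => simpa using hn
    | succ n ih =>
      rw [hstep _ (by simpa using Nat.cast_add_one_ne_zero n)] at hn
      exact ih (by simpa [add_assoc] using hn)
  have hleft : g.RegularAt b := by
    obtain ⟨n, hn⟩ := g.exists_regularAt (u := fun n : ℕ ↦ b - (n : L))
      fun m n hmn ↦ by simpa using hmn
    induction n with
    | zero => simpa using hn
    | succ n ih =>
      rw [← hstep _ (by simpa using Nat.cast_add_one_ne_zero n)] at hn
      refine ih ?_
      convert hn using 1
      push_cast
      ring
  refine eq_zero_of_regularAt_C_div_X_sub_C_pow (b := b) hs ?_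
  rw [h]
  exact ((regularAt_shift_iff hτC hτX g b).mpr hright).sub hleft

end Shift

end RatFunc

end RationalSummability


/-- Lemma 2.4: let `f = ∑_{ℓ=0}^d α_ℓ/(x-(β+ℓ))^s` over an algebraically closed field `L`
of characteristic zero, with `s ≥ 1`.  Then `f` is rational summable (i.e. `f = g(x+1)-g(x)`
for some rational function `g`) if and only if `∑_{ℓ=0}^d α_ℓ = 0`.
Here `τ` is the shift automorphism of `L(x)`, characterized by fixing constants and
sending `x` to `x + 1`. -/
theorem stmt1 {L : Type*} [Field L] [CharZero L] [IsAlgClosed L]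
    (d s : ℕ) (hs : 1 ≤ s) (α : ℕ → L) (β : L)
    (f : RatFunc L)
    (hf : f = ∑ ℓ ∈ Finset.range (d + 1),
      RatFunc.C (α ℓ) / (RatFunc.X - RatFunc.C (β + (ℓ : L))) ^ s)
    (τ : RatFunc L →+* RatFunc L)
    (hτC : ∀ a : L, τ (RatFunc.C a) = RatFunc.C a)
    (hτX : τ RatFunc.X = RatFunc.X + 1) :
    (∃ g : RatFunc L, f = τ g - g) ↔ ∑ ℓ ∈ Finset.range (d + 1), α ℓ = 0 := by
  choose h hh using fun ℓ ↦ RatFunc.exists_C_div_X_sub_C_pow_eq hτC hτX (α ℓ) β s ℓ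
  have hred : f = RatFunc.C (∑ ℓ ∈ Finset.range (d + 1), α ℓ) / (RatFunc.X - RatFunc.C β) ^ s +
      (τ (∑ ℓ ∈ Finset.range (d + 1), h ℓ) - ∑ ℓ ∈ Finset.range (d + 1), h ℓ) := by
    rw [hf, Finset.sum_congr rfl fun ℓ _ ↦ hh ℓ]
    simp only [Finset.sum_add_distrib, Finset.sum_sub_distrib, map_sum, Finset.sum_div]
  constructor
  · rintro ⟨g, hg⟩
    refine RatFunc.eq_zero_of_C_div_X_sub_C_pow_eq_shift_sub hτC hτX (b := β) (s := s)
      (g := g - ∑ ℓ ∈ Finset.range (d + 1), h ℓ) (by omega) ?_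
    rw [map_sub]
    linear_combination hg - hred
  · intro h0
    exact ⟨_, by rw [hred, h0, map_zero, zero_div, zero_add]⟩
end

section
/- A rational function f = a/b in K(x), with gcd(a,b)=1, is rational summable (f = Δ_x(g) for some g in K(x)) if and only if for every Z-orbit [β] of roots of b and every multiplicity j, the discrete residue dres_x(f,[β],j) is zero. -/
section PolarCoeff

open scoped RatFunc

/-- The coefficient of `(x - c)^(-(k+1))` in the Laurent expansion of a rational function
at `c`. -/
noncomputable def polarCoeff {L : Type*} [Field L] (c : L) (k : ℕ) : RatFunc L →+ L where
  toFun g := (algebraMap (RatFunc L) (LaurentSeries L) (RatFunc.laurent c g)).coeff (-(k + 1 : ℤ))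
  map_zero' := by simp
  map_add' := by simp

theorem polarCoeff_apply {L : Type*} [Field L] (c : L) (k : ℕ) (g : RatFunc L) :
    polarCoeff c k g =
      (algebraMap (RatFunc L) (LaurentSeries L) (RatFunc.laurent c g)).coeff (-(k + 1 : ℤ)) :=
  rfl

theorem polarCoeff_laurent_one {L : Type*} [Field L] (c : L) (k : ℕ) (g : RatFunc L) :
    polarCoeff c k (RatFunc.laurent 1 g) = polarCoeff (c + 1) k g := by
  rw [polarCoeff_apply, polarCoeff_apply, RatFunc.laurent_laurent]

theorem algebraMap_laurentSeries_algebraMap {L : Type*} [Field L] (p : Polynomial L) :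
    algebraMap (RatFunc L) (LaurentSeries L) (algebraMap (Polynomial L) (RatFunc L) p) =
      HahnSeries.ofPowerSeries ℤ L p :=
  (RatFunc.coe_coe p).symm

theorem polarCoeff_div_eq_zero {L : Type*} [Field L] {c : L} (k : ℕ) (p : Polynomial L)
    {q : Polynomial L} (hq : q.eval c ≠ 0) :
    polarCoeff c k (algebraMap (Polynomial L) (RatFunc L) p /
      algebraMap (Polynomial L) (RatFunc L) q) = 0 := by
  set Q : PowerSeries L := ((Polynomial.taylor c q : Polynomial L) : PowerSeries L)
  have hQ : PowerSeries.constantCoeff Q ≠ 0 := by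
    rw [← PowerSeries.coeff_zero_eq_constantCoeff_apply, Polynomial.coeff_coe,
      Polynomial.taylor_coeff_zero]
    exact hq
  have hQ0 : (HahnSeries.ofPowerSeries ℤ L) Q ≠ 0 := by
    intro h
    have : Q = 0 := HahnSeries.ofPowerSeries_injective (by rw [h, map_zero])
    simp [this] at hQ
  have h : algebraMap (RatFunc L) (LaurentSeries L) (RatFunc.laurent c
      (algebraMap (Polynomial L) (RatFunc L) p / algebraMap (Polynomial L) (RatFunc L) q)) =
      HahnSeries.ofPowerSeries ℤ L (((Polynomial.taylor c p : Polynomial L) : PowerSeries L) * Q⁻¹) := by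
    rw [RatFunc.laurent_div, map_div₀, div_eq_iff]
    · rw [algebraMap_laurentSeries_algebraMap, algebraMap_laurentSeries_algebraMap, ← map_mul, mul_assoc,
        PowerSeries.inv_mul_cancel _ hQ, mul_one]
    · rwa [algebraMap_laurentSeries_algebraMap]
  rw [polarCoeff_apply, h, PowerSeries.coeff_coe, if_pos (by omega)]

theorem polarCoeff_algebraMap {L : Type*} [Field L] (c : L) (k : ℕ) (p : Polynomial L) :
    polarCoeff c k (algebraMap (Polynomial L) (RatFunc L) p) = 0 := by
  simpa using polarCoeff_div_eq_zero (c := c) k p (q := 1) (by simp)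

theorem polarCoeff_simple_of_ne {L : Type*} [Field L] {c e : L} (h : c ≠ e) (k j : ℕ) (a : L) :
    polarCoeff c k (RatFunc.C a / (RatFunc.X - RatFunc.C e) ^ (j + 1)) = 0 := by
  have := polarCoeff_div_eq_zero (c := c) k (Polynomial.C a)
    (q := (Polynomial.X - Polynomial.C e) ^ (j + 1)) (by simpa [sub_eq_zero] using h)
  simpa using this

theorem polarCoeff_simple_self {L : Type*} [Field L] (c : L) (k j : ℕ) (a : L) :
    polarCoeff c k (RatFunc.C a / (RatFunc.X - RatFunc.C c) ^ (j + 1)) =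
      if k = j then a else 0 := by
  have h : algebraMap (RatFunc L) (LaurentSeries L) (RatFunc.laurent c
      (RatFunc.C a / (RatFunc.X - RatFunc.C c) ^ (j + 1))) =
      HahnSeries.single (-(j + 1 : ℤ)) a := by
    have h1 : RatFunc.laurent c (RatFunc.C a / (RatFunc.X - RatFunc.C c) ^ (j + 1)) =
        RatFunc.C a / RatFunc.X ^ (j + 1) := by
      simp
    have hC : algebraMap (RatFunc L) (LaurentSeries L) (RatFunc.C a) = HahnSeries.C a := by
      rw [← RatFunc.algebraMap_C, ← PowerSeries.coe_C, ← Polynomial.coe_C,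
        algebraMap_laurentSeries_algebraMap]
    rw [h1, map_div₀, hC, map_pow, RatFunc.coe_X, HahnSeries.single_pow, div_eq_iff]
    · simp [HahnSeries.C_apply, HahnSeries.single_mul_single]
    · simp
  rw [polarCoeff_apply, h, HahnSeries.coeff_single]
  simp [neg_inj]

end PolarCoeff

theorem finite_support_polarCoeff {L : Type*} [Field L] [CharZero L] (b : L) (k : ℕ)
    (g : RatFunc L) : (Function.support fun z : ℤ => polarCoeff (b + z) k g).Finite := by
  have hfin : {x | g.denom.IsRoot x}.Finite := Polynomial.finite_setOfPred_isRoot g.denom_ne_zero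
  refine (hfin.preimage (f := fun z : ℤ => b + (z : L)) ?_).subset ?_
  · intro x _ y _ h
    simpa using h
  · intro z hz
    by_contra hroot
    refine hz ?_
    have := polarCoeff_div_eq_zero k g.num hroot
    rwa [RatFunc.num_div_denom] at this

/-- The discrete residue of a rational function at the `ℤ`-orbit of `b`, of multiplicity `k + 1`. -/
noncomputable def discreteResidue {L : Type*} [Field L] [CharZero L] (b : L) (k : ℕ) :
    RatFunc L →+ L where
  toFun g := ∑ᶠ z : ℤ, polarCoeff (b + z) k g
  map_zero' := by simp
  map_add' g h := by
    simp_rw [map_add]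
    exact finsum_add_distrib (finite_support_polarCoeff b k g) (finite_support_polarCoeff b k h)

theorem discreteResidue_apply {L : Type*} [Field L] [CharZero L] (b : L) (k : ℕ)
    (g : RatFunc L) : discreteResidue b k g = ∑ᶠ z : ℤ, polarCoeff (b + z) k g := rfl

theorem discreteResidue_laurent_one {L : Type*} [Field L] [CharZero L] (b : L) (k : ℕ)
    (g : RatFunc L) : discreteResidue b k (RatFunc.laurent 1 g) = discreteResidue b k g := by
  simp_rw [discreteResidue_apply, polarCoeff_laurent_one]
  rw [← finsum_comp_equiv (Equiv.addRight (1 : ℤ)) (f := fun z : ℤ => polarCoeff (b + z) k g)]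
  simp [add_assoc]

theorem discreteResidue_algebraMap {L : Type*} [Field L] [CharZero L] (b : L) (k : ℕ)
    (p : Polynomial L) : discreteResidue b k (algebraMap (Polynomial L) (RatFunc L) p) = 0 := by
  simp [discreteResidue_apply, polarCoeff_algebraMap]

theorem discreteResidue_simple_of_ne {L : Type*} [Field L] [CharZero L] {b e : L}
    (h : ∀ z : ℤ, b + z ≠ e) (k j : ℕ) (a : L) :
    discreteResidue b k (RatFunc.C a / (RatFunc.X - RatFunc.C e) ^ (j + 1)) = 0 := by
  simp [discreteResidue_apply, polarCoeff_simple_of_ne (h _)]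

theorem discreteResidue_simple_self {L : Type*} [Field L] [CharZero L] (b : L) (l k j : ℕ)
    (a : L) :
    discreteResidue b k (RatFunc.C a / (RatFunc.X - RatFunc.C (b + (l : L))) ^ (j + 1)) =
      if k = j then a else 0 := by
  rw [discreteResidue_apply, finsum_eq_single _ (l : ℤ), Int.cast_natCast, polarCoeff_simple_self]
  intro z hz
  refine polarCoeff_simple_of_ne ?_ _ _ _
  intro h
  exact hz (by exact_mod_cast add_left_cancel h)

/-- The forward difference operator `g ↦ g(x+1) - g(x)` on rational functions. -/
noncomputable def RatFunc.fwdDiff (L : Type*) [Field L] : RatFunc L →ₗ[L] RatFunc L :=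
  (RatFunc.laurent 1).toLinearMap - LinearMap.id

theorem RatFunc.fwdDiff_apply {L : Type*} [Field L] (g : RatFunc L) :
    RatFunc.fwdDiff L g = RatFunc.laurent 1 g - g := rfl

theorem algebraMap_mem_range_fwdDiff {L : Type*} [Field L] [CharZero L] (p : Polynomial L) :
    algebraMap (Polynomial L) (RatFunc L) p ∈ LinearMap.range (RatFunc.fwdDiff L) := by
  induction p using Polynomial.induction_on' with
  | add p q hp hq => rw [map_add]; exact add_mem hp hq
  | monomial n a =>
    set B : Polynomial L := (Polynomial.bernoulli (n + 1)).map (algebraMap ℚ L)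
    have hB : Polynomial.taylor 1 B = B + (n + 1 : L) • Polynomial.X ^ n := by
      have h := congrArg (Polynomial.map (algebraMap ℚ L))
        (Polynomial.bernoulli_comp_one_add_X (n + 1))
      rw [Polynomial.map_comp] at h
      rw [Polynomial.taylor_apply, Polynomial.C_1, add_comm Polynomial.X]
      simpa [B, Polynomial.smul_eq_C_mul] using h
    refine ⟨algebraMap _ _ ((a / (n + 1)) • B), ?_⟩
    rw [RatFunc.fwdDiff_apply, RatFunc.laurent_algebraMap, ← map_sub, map_smul, hB, smul_add,
      add_sub_cancel_left, smul_smul, div_mul_cancel₀ _ (Nat.cast_add_one_ne_zero n),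
      Polynomial.smul_X_eq_monomial]

theorem simple_sub_simple_mem_range_fwdDiff {L : Type*} [Field L] (b a : L) (l j : ℕ) :
    RatFunc.C a / (RatFunc.X - RatFunc.C (b + (l : L))) ^ (j + 1) -
      RatFunc.C a / (RatFunc.X - RatFunc.C b) ^ (j + 1) ∈
        LinearMap.range (RatFunc.fwdDiff L) := by
  induction l with
  | zero => simp
  | succ l ih =>
    rw [← sub_add_sub_cancel _
      (RatFunc.C a / (RatFunc.X - RatFunc.C (b + (l : L))) ^ (j + 1)) _]
    refine add_mem ?_ ih
    refine ⟨-(RatFunc.C a / (RatFunc.X - RatFunc.C (b + ((l + 1 : ℕ) : L))) ^ (j + 1)), ?_⟩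
    have h : RatFunc.X + RatFunc.C 1 - RatFunc.C (b + ((l + 1 : ℕ) : L)) =
        RatFunc.X - RatFunc.C (b + (l : L)) := by
      push_cast
      simp only [map_add, map_one]
      ring
    rw [RatFunc.fwdDiff_apply, map_neg, map_div₀, map_pow, map_sub, RatFunc.laurent_X,
      RatFunc.laurent_C, RatFunc.laurent_C, h]
    ring

theorem sum_simple_mem_range_fwdDiff {L : Type*} [Field L] (b : L) (j : ℕ) (a : ℕ → L)
    (s : Finset ℕ) (hs : ∑ l ∈ s, a l = 0) :
    ∑ l ∈ s, RatFunc.C (a l) / (RatFunc.X - RatFunc.C (b + (l : L))) ^ (j + 1) ∈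
      LinearMap.range (RatFunc.fwdDiff L) := by
  have h := Submodule.sum_mem (LinearMap.range (RatFunc.fwdDiff L))
    fun l (_ : l ∈ s) => simple_sub_simple_mem_range_fwdDiff b (a l) l j
  rwa [Finset.sum_sub_distrib, ← Finset.sum_div, ← map_sum RatFunc.C, hs, map_zero, zero_div,
    sub_zero] at h

/-- Apply a linear form to each coefficient of a polynomial. -/
noncomputable def Polynomial.coeffwise {K L : Type*} [Field K] [Field L] [Algebra K L]
    (φ : L →ₗ[K] K) : Polynomial L →ₗ[K] Polynomial K :=
  Polynomial.lsum fun n => (Polynomial.monomial n).comp φ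

theorem Polynomial.coeff_coeffwise {K L : Type*} [Field K] [Field L] [Algebra K L]
    (φ : L →ₗ[K] K) (p : Polynomial L) (n : ℕ) :
    (Polynomial.coeffwise φ p).coeff n = φ (p.coeff n) := by
  induction p using Polynomial.induction_on' with
  | add p q hp hq => simp [hp, hq]
  | monomial m a =>
    simp only [Polynomial.coeffwise, Polynomial.lsum_apply, LinearMap.comp_apply]
    rw [Polynomial.sum_monomial_index _ _ (by simp), Polynomial.coeff_monomial,
      Polynomial.coeff_monomial]
    split_ifs <;> simp

theorem Polynomial.coeffwise_map_mul {K L : Type*} [Field K] [Field L] [Algebra K L]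
    (φ : L →ₗ[K] K) (q : Polynomial K) (p : Polynomial L) :
    Polynomial.coeffwise φ (q.map (algebraMap K L) * p) = q * Polynomial.coeffwise φ p := by
  ext n
  simp [Polynomial.coeff_coeffwise, Polynomial.coeff_mul, ← Algebra.smul_def]

theorem Polynomial.coeffwise_map {K L : Type*} [Field K] [Field L] [Algebra K L]
    {φ : L →ₗ[K] K} (hφ : φ 1 = 1) (q : Polynomial K) :
    Polynomial.coeffwise φ (q.map (algebraMap K L)) = q := by
  ext n
  rw [Polynomial.coeff_coeffwise, Polynomial.coeff_map, Algebra.algebraMap_eq_smul_one, map_smul,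
    hφ, smul_eq_mul, mul_one]

theorem Polynomial.coeffwise_taylor_one {K L : Type*} [Field K] [Field L] [Algebra K L]
    (φ : L →ₗ[K] K) (p : Polynomial L) :
    Polynomial.coeffwise φ (Polynomial.taylor 1 p) =
      Polynomial.taylor 1 (Polynomial.coeffwise φ p) := by
  induction p using Polynomial.induction_on' with
  | add p q hp hq => simp [hp, hq]
  | monomial n c =>
    have h : Polynomial.taylor 1 (Polynomial.monomial n c) =
        ((Polynomial.X + Polynomial.C 1 : Polynomial K) ^ n).map (algebraMap K L) *
          Polynomial.C c := by
      simp [Polynomial.taylor_monomial, mul_comm]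
    have hmon : ∀ m (e : L), Polynomial.coeffwise φ (Polynomial.monomial m e) =
        Polynomial.monomial m (φ e) := by
      intro m e
      ext k
      rw [Polynomial.coeff_coeffwise, Polynomial.coeff_monomial, Polynomial.coeff_monomial]
      split_ifs <;> simp
    rw [h, Polynomial.coeffwise_map_mul, hmon, Polynomial.taylor_monomial, mul_comm,
      ← Polynomial.monomial_zero_left, hmon, Polynomial.monomial_zero_left]

theorem Polynomial.map_taylor_one {K L : Type*} [Field K] [Field L] [Algebra K L]
    (p : Polynomial K) :
    (Polynomial.taylor 1 p).map (algebraMap K L) =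
      Polynomial.taylor 1 (p.map (algebraMap K L)) := by
  simp [Polynomial.taylor_apply, Polynomial.map_comp]

/-- Summability descends from an algebraic extension. -/
theorem exists_fwdDiff_eq_of_algebraic {K L : Type*} [Field K] [Field L] [Algebra K L]
    [Algebra.IsAlgebraic K L] (a : Polynomial K) {b : Polynomial K} (hb : b ≠ 0) (h : RatFunc L)
    (heq : algebraMap (Polynomial L) (RatFunc L) (a.map (algebraMap K L)) /
      algebraMap (Polynomial L) (RatFunc L) (b.map (algebraMap K L)) = RatFunc.fwdDiff L h) :
    ∃ g : RatFunc K, algebraMap (Polynomial K) (RatFunc K) a /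
      algebraMap (Polynomial K) (RatFunc K) b = RatFunc.fwdDiff K g := by
  obtain ⟨φ, hφ⟩ : ∃ φ : L →ₗ[K] K, φ 1 = 1 := by
    obtain ⟨φ, hφ⟩ := (Algebra.linearMap K L).exists_leftInverse_of_injective
      (LinearMap.ker_eq_bot.2 (algebraMap K L).injective)
    exact ⟨φ, by simpa using LinearMap.congr_fun hφ 1⟩
  obtain ⟨v, hv, w, hw⟩ :=
    Polynomial.exists_dvd_map_of_isAlgebraic (R := K) h.denom_ne_zero
  have hinj : Function.Injective (Polynomial.map (algebraMap K L)) :=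
    Polynomial.map_injective _ (algebraMap K L).injective
  have hmap : ∀ {q : Polynomial K}, q ≠ 0 → algebraMap (Polynomial L) (RatFunc L)
      (q.map (algebraMap K L)) ≠ 0 := fun hq =>
    RatFunc.algebraMap_ne_zero ((Polynomial.map_ne_zero_iff (algebraMap K L).injective).2 hq)
  have hv' : Polynomial.taylor 1 v ≠ 0 := by
    rwa [Ne, LinearMap.map_eq_zero_iff _ (Polynomial.taylor_injective _)]
  set u := h.num * w
  have hu : h = algebraMap (Polynomial L) (RatFunc L) u /
      algebraMap (Polynomial L) (RatFunc L) (v.map (algebraMap K L)) := by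
    have hw0 : algebraMap (Polynomial L) (RatFunc L) w ≠ 0 := by
      refine RatFunc.algebraMap_ne_zero ?_
      rintro rfl
      exact hv (hinj (by simpa using hw))
    rw [hw, map_mul, map_mul, mul_div_mul_right _ _ hw0, RatFunc.num_div_denom]
  have key : (a * v * Polynomial.taylor 1 v).map (algebraMap K L) =
      (b * v).map (algebraMap K L) * Polynomial.taylor 1 u -
        (b * Polynomial.taylor 1 v).map (algebraMap K L) * u := by
    rw [hu, RatFunc.fwdDiff_apply, RatFunc.laurent_div, ← Polynomial.map_taylor_one,
      div_sub_div _ _ (hmap hv') (hmap hv), div_eq_div_iff (hmap hb)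
      (mul_ne_zero (hmap hv') (hmap hv))] at heq
    simp only [← map_mul, ← map_sub] at heq
    have := RatFunc.algebraMap_injective L heq
    simp only [Polynomial.map_mul] at this ⊢
    linear_combination this
  have key' := congrArg (Polynomial.coeffwise φ) key
  rw [map_sub, Polynomial.coeffwise_map hφ, Polynomial.coeffwise_map_mul,
    Polynomial.coeffwise_map_mul, Polynomial.coeffwise_taylor_one] at key'
  refine ⟨algebraMap _ _ (Polynomial.coeffwise φ u) / algebraMap _ _ v, ?_⟩
  rw [RatFunc.fwdDiff_apply, RatFunc.laurent_div, div_sub_div _ _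
    (RatFunc.algebraMap_ne_zero hv') (RatFunc.algebraMap_ne_zero hv),
    div_eq_div_iff (RatFunc.algebraMap_ne_zero hb)
    (mul_ne_zero (RatFunc.algebraMap_ne_zero hv') (RatFunc.algebraMap_ne_zero hv))]
  simp only [← map_mul, ← map_sub]
  congr 1
  linear_combination key'

theorem RatFunc.ringHom_ext_C_X {K M : Type*} [Field K] [Field M]
    {σ ρ : RatFunc K →+* M} (hC : ∀ c, σ (RatFunc.C c) = ρ (RatFunc.C c))
    (hX : σ RatFunc.X = ρ RatFunc.X) : σ = ρ := by
  refine IsLocalization.ringHom_ext (nonZeroDivisors (Polynomial K)) ?_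
  refine Polynomial.ringHom_ext ?_ ?_
  · simpa using hC
  · simpa using hX


/-- Proposition 2.5: a rational function `f = a/b ∈ K(x)` with `gcd(a,b)=1` (`K` of
characteristic zero) is rational summable, i.e. `f = g(x+1) - g(x)` for some `g ∈ K(x)`,
if and only if all its discrete residues vanish.  Over the algebraic closure `f`
decomposes as `ι f = p + ∑_i ∑_j ∑_{ℓ=0}^{d_{i,j}} α_{i,j,ℓ}/(x-(β_i+ℓ))^{j+1}` with the
`β_i` in distinct `ℤ`-orbits; the discrete residue of `f` at the orbit `[β_i]` of
multiplicity `j+1` is `∑_ℓ α_{i,j,ℓ}`.  Here `ι : K(x) → K̄(x)` is the canonical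
inclusion and `τ` the shift automorphism `x ↦ x+1` of `K(x)`. -/
theorem stmt2 {K : Type*} [Field K] [CharZero K]
    (a b : Polynomial K) (hb : b ≠ 0) (hab : IsCoprime a b)
    (f : RatFunc K)
    (hf : f = algebraMap (Polynomial K) (RatFunc K) a /
              algebraMap (Polynomial K) (RatFunc K) b)
    (ι : RatFunc K →+* RatFunc (AlgebraicClosure K))
    (hιC : ∀ c : K, ι (RatFunc.C c) = RatFunc.C (algebraMap K (AlgebraicClosure K) c))
    (hιX : ι RatFunc.X = RatFunc.X)
    -- decomposition of `f` over the algebraic closure, `β i` in distinct `ℤ`-orbits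
    (p : Polynomial (AlgebraicClosure K)) (m : ℕ)
    (n : Fin m → ℕ) (d : (i : Fin m) → ℕ → ℕ)
    (α : (i : Fin m) → ℕ → ℕ → AlgebraicClosure K)
    (β : Fin m → AlgebraicClosure K)
    (hβ : ∀ i i' : Fin m, i ≠ i' → ∀ z : ℤ, β i ≠ β i' + (z : AlgebraicClosure K))
    (hdecomp : ι f =
      algebraMap (Polynomial (AlgebraicClosure K)) (RatFunc (AlgebraicClosure K)) p +
        ∑ i : Fin m, ∑ j ∈ Finset.range (n i), ∑ ℓ ∈ Finset.range (d i j + 1),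
          RatFunc.C (α i j ℓ) /
            (RatFunc.X - RatFunc.C (β i + (ℓ : AlgebraicClosure K))) ^ (j + 1))
    -- the shift automorphism of `K(x)`
    (τ : RatFunc K →+* RatFunc K)
    (hτC : ∀ c : K, τ (RatFunc.C c) = RatFunc.C c)
    (hτX : τ RatFunc.X = RatFunc.X + 1) :
    (∃ g : RatFunc K, f = τ g - g) ↔
      ∀ (i : Fin m), ∀ j ∈ Finset.range (n i),
        ∑ ℓ ∈ Finset.range (d i j + 1), α i j ℓ = 0 := by
  have hτ : ∀ g, τ g = RatFunc.laurent 1 g := by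
    have : τ = (RatFunc.laurent (1 : K) : RatFunc K →+* RatFunc K) :=
      RatFunc.ringHom_ext_C_X (by simpa using hτC) (by simpa using hτX)
    intro g
    rw [this]
    rfl
  have hιp : ∀ q : Polynomial K, ι (algebraMap _ _ q) =
      algebraMap _ _ (q.map (algebraMap K (AlgebraicClosure K))) := by
    intro q
    induction q using Polynomial.induction_on with
    | C c => simpa using hιC c
    | add p q hp hq => simp [hp, hq]
    | monomial n c _ => simp [hιC, hιX]
  have hιτ : ∀ g, ι (τ g) = RatFunc.laurent 1 (ι g) := by
    have : ι.comp τ =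
        (RatFunc.laurent (1 : AlgebraicClosure K) : _ →+* _).comp ι :=
      RatFunc.ringHom_ext_C_X (by simp [hτC, hιC]) (by simp [hτX, hιX])
    exact fun g => RingHom.congr_fun this g
  constructor
  · rintro ⟨g, hg⟩ i j hj
    have h0 : discreteResidue (β i) j (ι f) = 0 := by
      rw [hg, map_sub, map_sub, hιτ, discreteResidue_laurent_one, sub_self]
    rw [hdecomp, map_add, discreteResidue_algebraMap, zero_add, map_sum,
      Finset.sum_eq_single_of_mem i (Finset.mem_univ i), map_sum,
      Finset.sum_eq_single_of_mem j hj, map_sum] at h0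
    · simpa only [discreteResidue_simple_self, if_true] using h0
    · intro j' _ hne
      rw [map_sum]
      exact Finset.sum_eq_zero fun l _ => by rw [discreteResidue_simple_self, if_neg hne.symm]
    · intro i' _ hne
      rw [map_sum]
      refine Finset.sum_eq_zero fun j' _ => ?_
      rw [map_sum]
      refine Finset.sum_eq_zero fun l _ => discreteResidue_simple_of_ne (fun z hz => ?_) _ _ _
      refine hβ i i' hne.symm ((l : ℤ) - z) ?_
      push_cast
      linear_combination hz
  · intro hres
    have hmem : ι f ∈ LinearMap.range (RatFunc.fwdDiff (AlgebraicClosure K)) := by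
      rw [hdecomp]
      exact add_mem (algebraMap_mem_range_fwdDiff p) (Submodule.sum_mem _ fun i _ =>
        Submodule.sum_mem _ fun j hj => sum_simple_mem_range_fwdDiff (β i) j (α i j) _ (hres i j hj))
    obtain ⟨h, hh⟩ := hmem
    rw [hf, map_div₀, hιp, hιp] at hh
    obtain ⟨g, hg⟩ := exists_fwdDiff_eq_of_algebraic a hb h hh.symm
    exact ⟨g, by rw [hf, hg, hτ, RatFunc.fwdDiff_apply]⟩
end

section
/- Let k be an algebraically closed field of characteristic zero and α algebraic over k(t). If α satisfies a nonzero linear recurrence L(t,S_t)(α) = 0 with coefficients in k(t), where S_t is the shift t ↦ t+1 extended to the algebraic closure, then α ∈ k(t). -/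
open Polynomial

theorem Polynomial.eq_C_of_taylor_one_eq {k : Type*} [Field k] [CharZero k] {c : k[X]} {ν : k}
    (h : taylor 1 c = C ν * c) : c = C (c.coeff 0) := by
  rcases eq_or_ne c 0 with rfl | hc
  · simp
  have hν : ν = 1 := by
    have := congrArg leadingCoeff h
    rw [leadingCoeff_taylor, leadingCoeff_mul, leadingCoeff_C] at this
    exact (mul_eq_right₀ (leadingCoeff_ne_zero.2 hc)).1 this.symm
  subst hν
  have hn : ∀ n : ℕ, c.eval (n : k) = c.coeff 0 := by
    intro n
    induction n with
    | zero => simp [coeff_zero_eq_eval_zero]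
    | succ n ih =>
      have := taylor_eval 1 c (n : k)
      rw [h] at this
      simpa [ih] using this.symm
  refine eq_of_infinite_eval_eq _ _ ((Set.infinite_range_of_injective
    (Nat.cast_injective (R := k))).mono ?_)
  rintro _ ⟨n, rfl⟩
  simp [hn]

theorem Polynomial.exists_taylor_one_sub {k : Type*} [Field k] [CharZero k] (μ : k) (p : k[X]) :
    ∃ q : k[X], taylor 1 q - C μ * q = p := by
  induction hn : p.degree using WellFoundedLT.induction generalizing p with
  | ind n ih =>
  subst hn
  rcases eq_or_ne p 0 with rfl | hp
  · exact ⟨0, by simp⟩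
  suffices ∃ q : k[X], (taylor 1 q - C μ * q).degree = p.degree by
    obtain ⟨q, hq⟩ := this
    set r := taylor 1 q - C μ * q with hr
    have hr0 : r ≠ 0 := by rintro h; rw [h, degree_zero, eq_comm, degree_eq_bot] at hq; exact hp hq
    have hlc : r.leadingCoeff ≠ 0 := leadingCoeff_ne_zero.2 hr0
    obtain ⟨q', hq'⟩ := ih _ (degree_sub_lt_left
      (q := C (p.leadingCoeff / r.leadingCoeff) * r) (p := p)
      (by rw [degree_C_mul (div_ne_zero (leadingCoeff_ne_zero.2 hp) hlc), hq]) hp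
      (by rw [leadingCoeff_mul, leadingCoeff_C, div_mul_cancel₀ _ hlc])) _ rfl
    refine ⟨q' + C (p.leadingCoeff / r.leadingCoeff) * q, ?_⟩
    rw [map_add, taylor_mul, taylor_C]
    linear_combination hq' + C (p.leadingCoeff / r.leadingCoeff) * hr.symm
  rw [degree_eq_natDegree hp]
  set n := p.natDegree
  have hc : ∀ N m : ℕ, (taylor 1 (X ^ N) - C μ * X ^ N).coeff m
      = (N.choose m : k) - if m = N then μ else 0 := by
    intro N m
    rw [taylor_X_pow, C_1, coeff_sub, coeff_X_add_one_pow, coeff_C_mul_X_pow]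
  by_cases hμ : μ = 1
  · refine ⟨X ^ (n + 1), degree_eq_of_le_of_coeff_ne_zero ?_ ?_⟩
    · rw [degree_le_iff_coeff_zero]
      intro m hm
      rw [hc]
      rcases (Nat.succ_le_of_lt (Nat.cast_lt.1 hm)).eq_or_lt with rfl | h
      · simp [hμ]
      · simp [Nat.choose_eq_zero_of_lt h, h.ne']
    · rw [hc]
      simpa using Nat.cast_add_one_ne_zero (R := k) n
  · refine ⟨X ^ n, degree_eq_of_le_of_coeff_ne_zero ?_ ?_⟩
    · rw [degree_le_iff_coeff_zero]
      intro m hm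
      have h := Nat.cast_lt.1 hm
      rw [hc]
      simp [Nat.choose_eq_zero_of_lt h, h.ne']
    · rw [hc]
      simpa [sub_eq_zero] using Ne.symm hμ

section
variable {k L : Type*} [Field k] [CharZero k] [IsAlgClosed k] [Field L] [Algebra k L]
  [Algebra k[X] L] [IsScalarTower k k[X] L] [FaithfulSMul k[X] L]

theorem mem_range_of_isIntegral_of_shift_eq_mul (S : L →+* L)
    (hS : ∀ p : k[X], S (algebraMap k[X] L p) = algebraMap k[X] L (taylor 1 p))
    {b : L} (hb : IsIntegral k[X] b) {μ : k} (h : S b = algebraMap k L μ * b) :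
    b ∈ Set.range (algebraMap k L) := by
  rcases eq_or_ne μ 0 with rfl | hμ
  · rw [map_zero, zero_mul, map_eq_zero] at h
    exact ⟨0, by simp [h]⟩
  set p := minpoly k[X] b with hp
  have hpm : p.Monic := minpoly.monic hb
  set q := (p.map (taylorAlgHom (1 : k)).toRingHom).scaleRoots (C μ⁻¹) with hq
  have hqm : q.Monic := (monic_scaleRoots_iff _).2 (hpm.map _)
  have hroot : aeval b q = 0 := by
    have h1 : aeval (S b) (p.map (taylorAlgHom (1 : k)).toRingHom) = 0 := by
      rw [aeval_def, eval₂_map]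
      have : (algebraMap k[X] L).comp (taylorAlgHom (1 : k)).toRingHom
          = S.comp (algebraMap k[X] L) := by
        exact RingHom.ext fun x => by simp [hS]
      rw [this, ← hom_eval₂, ← aeval_def, minpoly.aeval, map_zero]
    have h2 := scaleRoots_aeval_eq_zero (r := C μ⁻¹) h1
    rwa [h, ← Polynomial.algebraMap_eq, ← IsScalarTower.algebraMap_apply, ← mul_assoc, ← map_mul,
      inv_mul_cancel₀ hμ, map_one, one_mul] at h2
  have hqp : q = p := by
    refine eq_of_monic_of_dvd_of_natDegree_le hpm hqm
      (minpoly.isIntegrallyClosed_dvd hb hroot) ?_ 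
    rw [hq, natDegree_scaleRoots]
    exact natDegree_map_le
  have hcoeff : ∀ i, p.coeff i = C ((p.coeff i).coeff 0) := by
    intro i
    refine eq_C_of_taylor_one_eq (ν := μ ^ (p.natDegree - i)) ?_
    have := congrArg (fun r => r.coeff i) hqp
    simp only [hq, coeff_scaleRoots, coeff_map, (hpm.natDegree_map)] at this
    nth_rw 2 [← this]
    simp only [← C_pow, inv_pow]
    rw [mul_left_comm, ← C_mul, mul_inv_cancel₀ (pow_ne_zero _ hμ)]
    simp
  have hint : IsIntegral k b := by
    refine ⟨p.map (evalRingHom 0), hpm.map _, ?_⟩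
    rw [eval₂_map]
    have : p.eval₂ (algebraMap k[X] L) b = 0 := minpoly.aeval _ _
    rw [eval₂_eq_sum_range] at this ⊢
    rw [← this]
    refine Finset.sum_congr rfl fun i _ => ?_
    conv_rhs => rw [hcoeff i, ← Polynomial.algebraMap_eq, ← IsScalarTower.algebraMap_apply]
    simp [coeff_zero_eq_eval_zero]
  exact minpoly.mem_range_of_degree_eq_one k b
    (IsAlgClosed.degree_eq_one_of_irreducible k (minpoly.irreducible hint))

theorem mem_range_of_aeval_shift_eq_zero (S : L →ₐ[k] L)
    (hS : ∀ p : k[X], S (algebraMap k[X] L p) = algebraMap k[X] L (taylor 1 p))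
    (s : Multiset k) : ∀ {b : L}, IsIntegral k[X] b →
    aeval S.toLinearMap (s.map (fun a => X - C a)).prod b = 0 →
    b ∈ Set.range (algebraMap k[X] L) := by
  induction s using Multiset.induction with
  | empty => intro b _ h; exact ⟨0, by simpa using h.symm⟩
  | cons μ s ih =>
    intro b hb h
    have hSb : IsIntegral k[X] (S b) := by
      refine hb.map_of_comp_eq (taylorAlgHom (1 : k)).toRingHom S.toRingHom ?_
      exact RingHom.ext fun x => by simp [hS]
    rw [Multiset.map_cons, Multiset.prod_cons, mul_comm, map_mul, Module.End.mul_apply] at h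
    have hμ : aeval S.toLinearMap (X - C μ) b = S b - algebraMap k L μ * b := by
      simp [Algebra.smul_def]
    have hμi : IsIntegral k[X] (algebraMap k L μ) := by
      rw [IsScalarTower.algebraMap_apply k k[X] L]; exact isIntegral_algebraMap
    rw [hμ] at h
    obtain ⟨p, hp⟩ := ih (hSb.sub (hμi.mul hb)) h
    obtain ⟨q, rfl⟩ := exists_taylor_one_sub μ p
    obtain ⟨c, hc⟩ := mem_range_of_isIntegral_of_shift_eq_mul S.toRingHom hS
      (b := b - algebraMap k[X] L q) (μ := μ) (hb.sub isIntegral_algebraMap) (by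
        simp only [map_sub, map_mul, ← Polynomial.algebraMap_eq,
          ← IsScalarTower.algebraMap_apply k k[X] L] at hp
        simp only [AlgHom.toRingHom_eq_coe, RingHom.coe_coe, map_sub, hS]
        linear_combination - hp)
    refine ⟨q + C c, ?_⟩
    rw [map_add, ← Polynomial.algebraMap_eq, ← IsScalarTower.algebraMap_apply, hc]
    ring

theorem mem_range_of_mem_finiteDimensional_shift_invariant (S : L →ₐ[k] L)
    (hS : ∀ p : k[X], S (algebraMap k[X] L p) = algebraMap k[X] L (taylor 1 p))
    (F : Submodule k L) [FiniteDimensional k F] (hF : ∀ x ∈ F, S x ∈ F)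
    {b : L} (hbF : b ∈ F) (hb : IsIntegral k[X] b) :
    b ∈ Set.range (algebraMap k[X] L) := by
  have hF' : ∀ x ∈ F, S.toLinearMap x ∈ F := hF
  set f : F →ₗ[k] F := S.toLinearMap.restrict hF' with hf
  have hsplit := (IsAlgClosed.splits f.charpoly).eq_prod_roots_of_monic f.charpoly_monic
  refine mem_range_of_aeval_shift_eq_zero S hS f.charpoly.roots hb ?_
  rw [← hsplit]
  have h0 := congrArg Subtype.val (LinearMap.congr_fun f.aeval_self_charpoly ⟨b, hbF⟩)
  have key : ∀ (p : k[X]) (x : F), ((aeval f p x : F) : L) = aeval S.toLinearMap p (x : L) := by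
    intro p x
    induction p using Polynomial.induction_on' with
    | add p q hp hq => simp [hp, hq]
    | monomial n a =>
      simp only [aeval_monomial, Module.End.mul_apply, Module.algebraMap_end_apply,
        Submodule.coe_smul]
      rw [hf, Module.End.pow_restrict]
      rfl
  rw [key] at h0
  exact h0
end

/-- The ring of rational functions that are regular at infinity. -/
noncomputable def RatFunc.regularAtInfinity (k : Type*) [Field k] : Subring (RatFunc k) :=
  letI := Classical.decEq (RatFunc k)
  (RatFunc.inftyValuation k).integer

namespace RatFunc

variable {k : Type*} [Field k]

theorem mem_regularAtInfinity_iff {x : RatFunc k} :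
    x ∈ regularAtInfinity k ↔ x.intDegree ≤ 0 := by
  classical
  rw [regularAtInfinity, Valuation.mem_integer_iff, inftyValuation_apply]
  rcases eq_or_ne x 0 with rfl | hx
  · simp [inftyValuationDef]
  · rw [inftyValuation_of_nonzero _ hx, ← WithZero.exp_zero, WithZero.exp_le_exp]

instance : IsFractionRing (regularAtInfinity k) (RatFunc k) :=
  letI := Classical.decEq (RatFunc k)
  (Valuation.integer.integers (RatFunc.inftyValuation k)).isFractionRing

instance : IsIntegrallyClosed (regularAtInfinity k) :=
  letI := Classical.decEq (RatFunc k)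
  (Valuation.integer.integers (RatFunc.inftyValuation k)).isIntegrallyClosed

theorem intDegree_pow {x : RatFunc k} (hx : x ≠ 0) (n : ℕ) :
    (x ^ n).intDegree = n * x.intDegree := by
  induction n with
  | zero => simp
  | succ n ih => rw [pow_succ, intDegree_mul (pow_ne_zero n hx) hx, ih]; push_cast; ring

theorem intDegree_X_inv_pow (n : ℕ) : ((X⁻¹ : RatFunc k) ^ n).intDegree = -n := by
  rw [intDegree_pow (inv_ne_zero X_ne_zero), intDegree_inv, intDegree_X]; ring

theorem exists_isIntegral_X_inv_pow_mul {L : Type*} [Field L] [Algebra (RatFunc k) L] {x : L}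
    (hx : IsAlgebraic (RatFunc k) x) :
    ∃ n : ℕ, IsIntegral (regularAtInfinity k) (algebraMap (RatFunc k) L (X⁻¹ ^ n) * x) := by
  obtain ⟨y, hy, hi⟩ :=
    ((IsFractionRing.isAlgebraic_iff (regularAtInfinity k) (RatFunc k) L).2
      hx).exists_integral_multiple
  have hy' : (y : RatFunc k) ≠ 0 := fun h => hy (Subtype.ext h)
  refine ⟨(y : RatFunc k).intDegree.natAbs, ?_⟩
  set n := (y : RatFunc k).intDegree.natAbs with hn
  have hmem : X⁻¹ ^ n * (y : RatFunc k)⁻¹ ∈ regularAtInfinity k := by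
    rw [mem_regularAtInfinity_iff, intDegree_mul (pow_ne_zero _ (inv_ne_zero X_ne_zero))
      (inv_ne_zero hy'), intDegree_X_inv_pow, intDegree_inv]
    omega
  convert! hi.smul (⟨_, hmem⟩ : regularAtInfinity k) using 1
  rw [Subring.smul_def, Subring.smul_def, Algebra.smul_def, Algebra.smul_def, ← mul_assoc,
    ← map_mul, mul_assoc, inv_mul_cancel₀ hy', mul_one]

/-- The shift `X ↦ X + 1` of rational functions. -/
noncomputable def shift (k : Type*) [Field k] : RatFunc k →+* RatFunc k :=
  IsFractionRing.map (A := k[X]) (j := (taylorAlgHom (1 : k)).toRingHom) (taylor_injective 1)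

@[simp]
theorem shift_algebraMap_s7 (p : k[X]) :
    shift k (algebraMap k[X] (RatFunc k) p) = algebraMap k[X] (RatFunc k) (taylor 1 p) :=
  IsLocalization.map_eq (T := nonZeroDivisors k[X])
    (nonZeroDivisors_le_comap_nonZeroDivisors_of_injective
      (taylorAlgHom (1 : k)).toRingHom (taylor_injective 1)) _

theorem intDegree_shift (x : RatFunc k) : (shift k x).intDegree = x.intDegree := by
  rcases eq_or_ne x 0 with rfl | hx
  · simp
  obtain ⟨p, q, hq, rfl⟩ := IsFractionRing.div_surjective (A := k[X]) x
  have hq' := nonZeroDivisors.ne_zero hq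
  have hp' : p ≠ 0 := by rintro rfl; simp at hx
  rw [map_div₀, shift_algebraMap_s7, shift_algebraMap_s7, intDegree_div, intDegree_div] <;>
  simp [hp', hq', taylor_eq_zero, intDegree_polynomial]

theorem apply_algebraMap_eq_shift {E : Type*} [Field E] [Algebra k[X] E] [Algebra (RatFunc k) E]
    [IsScalarTower k[X] (RatFunc k) E] {S : E →+* E}
    (hS : ∀ p : k[X], S (algebraMap k[X] E p) = algebraMap k[X] E (taylor 1 p)) (x : RatFunc k) :
    S (algebraMap (RatFunc k) E x) = algebraMap (RatFunc k) E (shift k x) := by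
  obtain ⟨p, q, hq, rfl⟩ := IsFractionRing.div_surjective (A := k[X]) x
  simp only [map_div₀, shift_algebraMap_s7, ← IsScalarTower.algebraMap_apply, hS]

/-- The elements of an extension of `k(X)` that are integral over `k[X]` and have poles of order
at most `n` (relative to `X`) at infinity. -/
noncomputable def polesLE (k L : Type*) [Field k] [Field L] [Algebra k L] [Algebra k[X] L]
    [Algebra (RatFunc k) L] [IsScalarTower k k[X] L] [IsScalarTower k (RatFunc k) L]
    (n : ℕ) : Submodule k L where
  carrier := {x | IsIntegral k[X] x ∧
    IsIntegral (regularAtInfinity k) (algebraMap (RatFunc k) L (X⁻¹ ^ n) * x)}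
  add_mem' := fun hx hy => ⟨hx.1.add hy.1, by rw [mul_add]; exact hx.2.add hy.2⟩
  zero_mem' := ⟨isIntegral_zero, by rw [mul_zero]; exact isIntegral_zero⟩
  smul_mem' := fun c x hx => by
    refine ⟨?_, ?_⟩
    · rw [← algebraMap_smul k[X] c x]
      exact hx.1.smul _
    · have hc : algebraMap k (RatFunc k) c ∈ regularAtInfinity k := by
        rw [mem_regularAtInfinity_iff, algebraMap_eq_C, intDegree_C]
      convert! hx.2.smul (⟨_, hc⟩ : regularAtInfinity k) using 1
      rw [Subring.smul_def, algebraMap_smul, mul_smul_comm]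

section
variable {E : Type*} [Field E] [Algebra k E] [Algebra k[X] E]
    [Algebra (RatFunc k) E] [IsScalarTower k k[X] E] [IsScalarTower k (RatFunc k) E]

theorem mem_polesLE {n : ℕ} {x : E} : x ∈ polesLE k E n ↔ IsIntegral k[X] x ∧
    IsIntegral (regularAtInfinity k) (algebraMap (RatFunc k) E (X⁻¹ ^ n) * x) := Iff.rfl

theorem exists_mem_polesLE [IsScalarTower k[X] (RatFunc k) E] {x : E} (hx : IsIntegral k[X] x) :
    ∃ n, x ∈ polesLE k E n := by
  obtain ⟨n, hn⟩ := exists_isIntegral_X_inv_pow_mul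
    (hx.tower_top (A := RatFunc k)).isAlgebraic
  exact ⟨n, hx, hn⟩

theorem trace_mul_mem [IsScalarTower k[X] (RatFunc k) E] [FiniteDimensional (RatFunc k) E]
    {m n : ℕ} {x y : E}
    (hx : x ∈ polesLE k E m) (hy : y ∈ polesLE k E n) :
    Algebra.trace (RatFunc k) E (x * y) ∈
      (degreeLE k (m + n : ℕ)).map (IsScalarTower.toAlgHom k k[X] (RatFunc k)).toLinearMap := by
  obtain ⟨p, hp⟩ := IsIntegrallyClosed.isIntegral_iff.1
    (Algebra.isIntegral_trace (L := RatFunc k) (hx.1.mul hy.1))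
  refine ⟨p, mem_degreeLE.2 ?_, hp⟩
  have h := Algebra.isIntegral_trace (L := RatFunc k) (hx.2.mul hy.2)
  rw [mul_mul_mul_comm, ← map_mul, ← pow_add, ← Algebra.smul_def, map_smul, ← hp] at h
  obtain ⟨z, hz⟩ := IsIntegrallyClosed.isIntegral_iff.1 h
  have hz' := mem_regularAtInfinity_iff.1 z.2
  change (algebraMap (regularAtInfinity k) (RatFunc k) z).intDegree ≤ 0 at hz'
  rcases eq_or_ne p 0 with rfl | hp0
  · simp
  rw [hz, smul_eq_mul, intDegree_mul (pow_ne_zero _ (inv_ne_zero X_ne_zero))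
    (by simpa using hp0), intDegree_X_inv_pow, intDegree_polynomial] at hz'
  exact degree_le_of_natDegree_le (by omega)

theorem finiteDimensional_polesLE [CharZero k] [IsScalarTower k[X] (RatFunc k) E]
    [FiniteDimensional (RatFunc k) E] (n : ℕ) : FiniteDimensional k (polesLE k E n) := by
  obtain ⟨s, b, hb⟩ := FiniteDimensional.exists_is_basis_integral k[X] (RatFunc k) E
  choose m hm using fun i => exists_mem_polesLE (hb i)
  let W : s → Submodule k (RatFunc k) := fun i =>
    (degreeLE k (n + m i : ℕ)).map (IsScalarTower.toAlgHom k k[X] (RatFunc k)).toLinearMap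
  have hW : ∀ i, FiniteDimensional k (W i) := fun i => by
    have : FiniteDimensional k (degreeLE k (n + m i : ℕ)) := by
      rw [← degreeLT_succ_eq_degreeLE]
      exact Module.Finite.equiv (degreeLTEquiv k _).symm
    infer_instance
  let T : polesLE k E n →ₗ[k] (Π i, W i) := LinearMap.pi fun i =>
    (((Algebra.trace (RatFunc k) E).restrictScalars k) ∘ₗ LinearMap.mulRight k (b i) ∘ₗ
      (polesLE k E n).subtype).codRestrict (W i) fun x => trace_mul_mem x.2 (hm i)
  refine FiniteDimensional.of_injective T ((injective_iff_map_eq_zero T).2 fun x hx => ?_)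
  refine Subtype.ext ((traceForm_nondegenerate (RatFunc k) E).1 x.1 fun y => ?_)
  have h : Algebra.traceForm (RatFunc k) E x.1 = 0 := b.ext fun i =>
    congrArg Subtype.val (congrFun hx i)
  rw [h, LinearMap.zero_apply]

theorem map_mem_polesLE [IsScalarTower k[X] (RatFunc k) E] {S : E →+* E}
    (hS : ∀ p : k[X], S (algebraMap k[X] E p) = algebraMap k[X] E (taylor 1 p)) {n : ℕ} {x : E}
    (hx : x ∈ polesLE k E n) : S x ∈ polesLE k E n := by
  refine ⟨hx.1.map_of_comp_eq (taylorAlgHom (1 : k)).toRingHom S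
    (RingHom.ext fun p => by simp [hS]), ?_⟩
  have h := hx.2.map_of_comp_eq ((shift k).restrict (regularAtInfinity k) (regularAtInfinity k)
    fun y hy => mem_regularAtInfinity_iff.2 (by
      rw [intDegree_shift]; exact mem_regularAtInfinity_iff.1 hy)) S
    (RingHom.ext fun y => (apply_algebraMap_eq_shift hS (y : RatFunc k)).symm)
  have hX : shift k X ≠ 0 := (_root_.map_ne_zero _).2 X_ne_zero
  have hmem : X⁻¹ ^ n * shift k X ^ n ∈ regularAtInfinity k := by
    rw [mem_regularAtInfinity_iff, intDegree_mul (pow_ne_zero _ (inv_ne_zero X_ne_zero))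
      (pow_ne_zero _ hX), intDegree_X_inv_pow, intDegree_pow hX, intDegree_shift, intDegree_X]
    simp
  convert! h.smul (⟨_, hmem⟩ : regularAtInfinity k) using 1
  rw [Subring.smul_def, Algebra.smul_def, map_mul S, apply_algebraMap_eq_shift hS, ← mul_assoc,
    ← map_mul, mul_assoc, map_pow (shift k), map_inv₀, ← mul_pow, mul_inv_cancel₀ hX, one_pow,
    mul_one]

theorem algHom_mem_polesLE_iff {F : Type*} [Field F] [Algebra k F] [Algebra k[X] F]
    [Algebra (RatFunc k) F] [IsScalarTower k k[X] F] [IsScalarTower k (RatFunc k) F]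
    [IsScalarTower k[X] (RatFunc k) F] [IsScalarTower k[X] (RatFunc k) E]
    (f : F →ₐ[RatFunc k] E) {n : ℕ} {x : F} : f x ∈ polesLE k E n ↔ x ∈ polesLE k F n := by
  rw [mem_polesLE, mem_polesLE, ← f.commutes, ← map_mul]
  exact and_congr (isIntegral_algHom_iff (f.restrictScalars k[X]) f.injective)
    (isIntegral_algHom_iff (f.restrictScalars (regularAtInfinity k)) f.injective)

theorem finiteDimensional_polesLE_inf [CharZero k] [IsScalarTower k[X] (RatFunc k) E]
    [Algebra.IsAlgebraic (RatFunc k) E] (n : ℕ) (V : Submodule (RatFunc k) E)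
    [FiniteDimensional (RatFunc k) V] :
    FiniteDimensional k ↥(polesLE k E n ⊓ V.restrictScalars k) := by
  obtain ⟨s, rfl⟩ := (Submodule.fg_iff_finiteDimensional V).2 inferInstance
  set F := IntermediateField.adjoin (RatFunc k) (s : Set E)
  have hF : FiniteDimensional (RatFunc k) F :=
    IntermediateField.finiteDimensional_adjoin fun x _ =>
      (Algebra.IsAlgebraic.isAlgebraic x).isIntegral
  have hsF : Submodule.span (RatFunc k) (s : Set E) ≤ F.toSubalgebra.toSubmodule :=
    Submodule.span_le.2 (IntermediateField.subset_adjoin _ _)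
  have : IsScalarTower k k[X] F := ⟨fun a p x => Subtype.ext (smul_assoc a p (x : E))⟩
  have := finiteDimensional_polesLE (k := k) (E := F) n
  refine Submodule.finiteDimensional_of_le
    (S₂ := (polesLE k F n).map (F.val.restrictScalars k).toLinearMap) fun x hx => ?_
  exact ⟨⟨x, hsF hx.2⟩, (algHom_mem_polesLE_iff F.val).1 hx.1, rfl⟩
end
end RatFunc

theorem exists_invariant_submodule {K L : Type*} [Field K] [Field L] [Algebra K L] (σ : RingAut L)
    (τ : K → K) (hτ : ∀ x, σ (algebraMap K L x) = algebraMap K L (τ x)) (α : L) (n : ℕ)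
    (a : Fin (n + 1) → K) (ha : a ≠ 0)
    (hrec : ∑ i, algebraMap K L (a i) * (σ ^ i.val) α = 0) :
    ∃ V : Submodule K L, FiniteDimensional K V ∧ α ∈ V ∧ ∀ x ∈ V, σ x ∈ V := by
  induction n with
  | zero =>
    have h0 : a 0 ≠ 0 := fun h => ha (funext fun i => by rw [Fin.fin_one_eq_zero i]; exact h)
    have : α = 0 := by simpa [h0] using hrec
    exact ⟨⊥, inferInstance, by simp [this], by simp⟩
  | succ n ih =>
    by_cases hl : a (Fin.last _) = 0
    · refine ih (fun i => a i.castSucc) (fun h => ha (funext fun i => ?_)) ?_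
      · induction i using Fin.lastCases with
        | last => exact hl
        | cast i => exact congrFun h i
      · rw [Fin.sum_univ_castSucc] at hrec
        simpa [hl] using hrec
    · set V := Submodule.span K (Set.range fun i : Fin (n + 1) => (σ ^ i.val) α) with hV
      have hmem : ∀ i : Fin (n + 1), (σ ^ i.val) α ∈ V := fun i => Submodule.subset_span ⟨i, rfl⟩
      have hlast : (σ ^ (n + 1)) α ∈ V := by
        rw [Fin.sum_univ_castSucc] at hrec
        rw [← V.smul_mem_iff hl, Algebra.smul_def]
        have h := eq_neg_of_add_eq_zero_right hrec
        rw [Fin.val_last] at h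
        rw [h]
        refine V.neg_mem (V.sum_mem fun i _ => ?_)
        rw [← Algebra.smul_def]
        exact V.smul_mem _ (hmem i)
      refine ⟨V, FiniteDimensional.span_of_finite K (Set.finite_range _), hmem 0, fun x hx => ?_⟩
      induction hx using Submodule.span_induction with
      | mem x hx =>
        obtain ⟨i, rfl⟩ := hx
        change (σ * σ ^ i.val) α ∈ V
        rw [← pow_succ']
        rcases (Nat.succ_le_of_lt i.2).eq_or_lt with h | h
        · rw [Nat.succ_eq_add_one] at h; rw [h]; exact hlast
        · exact hmem ⟨_, h⟩
      | zero => simp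
      | add x y _ _ hx hy => rw [map_add]; exact V.add_mem hx hy
      | smul c x _ hx => rw [Algebra.smul_def, map_mul, hτ, ← Algebra.smul_def]; exact V.smul_mem _ hx

theorem RatFunc.mem_range_of_shift_recurrence {k L : Type*} [Field k] [CharZero k] [IsAlgClosed k]
    [Field L] [Algebra k L] [Algebra k[X] L] [Algebra (RatFunc k) L] [IsScalarTower k k[X] L]
    [IsScalarTower k (RatFunc k) L] [IsScalarTower k[X] (RatFunc k) L]
    [Algebra.IsAlgebraic (RatFunc k) L] (σ : RingAut L)
    (hσk : ∀ a : k,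
      σ (algebraMap (RatFunc k) L (RatFunc.C a)) = algebraMap (RatFunc k) L (RatFunc.C a))
    (hσt : σ (algebraMap (RatFunc k) L RatFunc.X) = algebraMap (RatFunc k) L RatFunc.X + 1)
    (α : L) (n : ℕ) (a : Fin (n + 1) → RatFunc k) (ha : a ≠ 0)
    (hrec : ∑ i, algebraMap (RatFunc k) L (a i) * (σ ^ i.val) α = 0) :
    α ∈ Set.range (algebraMap (RatFunc k) L) := by
  have : FaithfulSMul k[X] L := FaithfulSMul.trans k[X] (RatFunc k) L
  have hS : ∀ p : k[X], σ (algebraMap k[X] L p) = algebraMap k[X] L (taylor 1 p) := by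
    suffices h : (σ : L →+* L).comp (algebraMap k[X] L)
        = (algebraMap k[X] L).comp (taylorAlgHom (1 : k)).toRingHom from
      fun p => RingHom.congr_fun h p
    refine Polynomial.ringHom_ext (fun c => ?_) ?_
    · simpa [IsScalarTower.algebraMap_apply k[X] (RatFunc k) L] using hσk c
    · simpa [IsScalarTower.algebraMap_apply k[X] (RatFunc k) L] using hσt
  have hSk : ∀ c : k, σ (algebraMap k L c) = algebraMap k L c := fun c => by
    rw [IsScalarTower.algebraMap_apply k (RatFunc k) L, RatFunc.algebraMap_eq_C, hσk]
  let S : L →ₐ[k] L := { (σ : L →+* L) with commutes' := hSk }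
  obtain ⟨V, hV, hαV, hσV⟩ := exists_invariant_submodule σ (RatFunc.shift k)
    (RatFunc.apply_algebraMap_eq_shift (S := (σ : L →+* L)) hS) α n a ha hrec
  obtain ⟨y, hy, hyα⟩ := ((IsFractionRing.isAlgebraic_iff k[X] (RatFunc k) L).2
    (Algebra.IsAlgebraic.isAlgebraic α)).exists_integral_multiple
  obtain ⟨m, hm⟩ := RatFunc.exists_mem_polesLE hyα
  have := RatFunc.finiteDimensional_polesLE_inf m V
  have hyV : y • α ∈ V := by
    rw [← algebraMap_smul (RatFunc k) y α]
    exact V.smul_mem _ hαV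
  obtain ⟨p, hp⟩ := mem_range_of_mem_finiteDimensional_shift_invariant S hS
    (RatFunc.polesLE k L m ⊓ V.restrictScalars k)
    (fun x hx => ⟨RatFunc.map_mem_polesLE (S := (σ : L →+* L)) hS hx.1, hσV x hx.2⟩)
    ⟨hm, hyV⟩ hyα
  have hy' : algebraMap k[X] L y ≠ 0 := by simpa using hy
  refine ⟨algebraMap k[X] (RatFunc k) p / algebraMap k[X] (RatFunc k) y, ?_⟩
  rw [map_div₀, ← IsScalarTower.algebraMap_apply, ← IsScalarTower.algebraMap_apply, hp,
    Algebra.smul_def, mul_div_cancel_left₀ _ hy']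

/-- Proposition 3.2: let `k` be algebraically closed of characteristic zero and `σ` an
extension to the algebraic closure of `k(t)` of the shift automorphism `t ↦ t+1` of
`k(t)`.  If `α`, algebraic over `k(t)`, satisfies a nonzero linear recurrence
`∑ a_i · σ^i(α) = 0` with coefficients `a_i ∈ k(t)`, then `α ∈ k(t)`. -/
theorem stmt7 {k : Type*} [Field k] [CharZero k] [IsAlgClosed k]
    (σ : RingAut (AlgebraicClosure (RatFunc k)))
    (hσk : ∀ a : k, σ (algebraMap (RatFunc k) (AlgebraicClosure (RatFunc k)) (RatFunc.C a))
      = algebraMap (RatFunc k) (AlgebraicClosure (RatFunc k)) (RatFunc.C a))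
    (hσt : σ (algebraMap (RatFunc k) (AlgebraicClosure (RatFunc k)) RatFunc.X)
      = algebraMap (RatFunc k) (AlgebraicClosure (RatFunc k)) RatFunc.X + 1)
    (α : AlgebraicClosure (RatFunc k))
    (n : ℕ) (a : Fin (n + 1) → RatFunc k) (ha : a ≠ 0)
    (hrec : ∑ i : Fin (n + 1),
      algebraMap (RatFunc k) (AlgebraicClosure (RatFunc k)) (a i) * (σ ^ i.val) α = 0) :
    α ∈ Set.range (algebraMap (RatFunc k) (AlgebraicClosure (RatFunc k))) := by
  exact RatFunc.mem_range_of_shift_recurrence σ hσk hσt α n a ha hrec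
end

section
/- Let k be an algebraically closed field of characteristic zero, q ∈ k not a root of unity, and α algebraic over k(t). If α satisfies a nonzero linear q-recurrence L(t,Q_t)(α) = 0 with coefficients in k(t), where Q_t is the q-shift t ↦ qt, then α ∈ k(t^{1/n}) for some positive integer n. -/
open Polynomial

theorem pow_injective_of_forall_ne_one {k : Type*} [Field k] {q : k} (hq0 : q ≠ 0)
    (hq : ∀ n : ℕ, 0 < n → q ^ n ≠ 1) : Function.Injective (fun n : ℕ => q ^ n) := by
  have key : ∀ a b : ℕ, a < b → q ^ a ≠ q ^ b := fun a b hab h => by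
    refine hq (b - a) (by omega) ?_
    rw [pow_sub₀ q hq0 hab.le, ← h, mul_inv_cancel₀ (pow_ne_zero _ hq0)]
  intro a b h
  rcases lt_trichotomy a b with hab | hab | hab
  · exact absurd h (key a b hab)
  · exact hab
  · exact absurd h.symm (key b a hab)

/-- `τ` is the substitution `t ↦ q t` on `k(t)`. -/
def IsQShift {k : Type*} [Field k] (q : k) (τ : RatFunc k ≃+* RatFunc k) : Prop :=
  ∀ p : k[X], τ (algebraMap k[X] (RatFunc k) p) =
    algebraMap k[X] (RatFunc k) (p.comp (C q * X))

theorem eq_C_mul_X_pow_of_dvd_comp {k : Type*} [Field k] {q : k} (hq0 : q ≠ 0)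
    (hq : Function.Injective (fun n : ℕ => q ^ n)) {d : k[X]} (hd : d ∣ d.comp (C q * X)) :
    d = C d.leadingCoeff * X ^ d.natDegree := by
  rcases eq_or_ne d 0 with rfl | hd0
  · simp
  obtain ⟨e, he⟩ := hd
  have hne : d.comp (C q * X) ≠ 0 := by
    intro h
    have := congrArg (fun p => p.coeff d.natDegree) h
    simp [comp_C_mul_X_coeff, hd0, hq0] at this
  have he0 : e ≠ 0 := by rintro rfl; simp_all
  have hdeg : e.natDegree = 0 := by
    have := congrArg natDegree he
    rw [natDegree_mul hd0 he0, natDegree_comp, natDegree_C_mul_X _ hq0] at this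
    omega
  rw [eq_C_of_natDegree_eq_zero hdeg, mul_comm d] at he
  have hc : ∀ i, d.coeff i * q ^ i = e.coeff 0 * d.coeff i := fun i => by
    rw [← comp_C_mul_X_coeff, he, coeff_C_mul]
  have hl : q ^ d.natDegree = e.coeff 0 := by
    have := hc d.natDegree
    rw [mul_comm] at this
    exact mul_right_cancel₀ (by simpa using hd0) this
  ext i
  rw [coeff_C_mul_X_pow]
  split_ifs with h
  · rw [h]; rfl
  · by_contra h0
    have := hc i
    rw [mul_comm, ← hl] at this
    exact h (hq (mul_right_cancel₀ h0 this))

section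
variable {k : Type*} [Field k] {q : k} {τ : RatFunc k ≃+* RatFunc k}

theorem IsQShift.map_C (hτ : IsQShift q τ) (a : k) :
    τ (RatFunc.C a) = RatFunc.C a := by
  rw [← RatFunc.algebraMap_C, hτ _, C_comp]

theorem IsQShift.map_X (hτ : IsQShift q τ) :
    τ RatFunc.X = RatFunc.C q * RatFunc.X := by
  rw [← RatFunc.algebraMap_X, hτ _, X_comp, map_mul, RatFunc.algebraMap_C]

theorem IsQShift.mul_comp_eq
    (hτ : IsQShift q τ)
    (h : RatFunc k) :
    τ h * algebraMap k[X] _ (h.denom.comp (C q * X)) =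
      algebraMap k[X] _ (h.num.comp (C q * X)) := by
  rw [← hτ h.denom, ← hτ h.num, ← map_mul]
  congr 1
  nth_rewrite 1 [← RatFunc.num_div_denom h]
  exact div_mul_cancel₀ _ (by simpa using h.denom_ne_zero)

theorem IsQShift.eq_C_mul_X_zpow (hq0 : q ≠ 0)
    (hq : Function.Injective (fun n : ℕ => q ^ n))
    (hτ : IsQShift q τ)
    {h : RatFunc k} (h0 : h ≠ 0) {μ : k} (hh : τ h = RatFunc.C μ * h) :
    ∃ (c : k) (m : ℤ), h = RatFunc.C c * RatFunc.X ^ m ∧ q ^ m = μ := by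
  have h1 := IsQShift.mul_comp_eq hτ h
  have hd : algebraMap k[X] (RatFunc k) h.denom ≠ 0 := by simpa using h.denom_ne_zero
  have h2 : h.num.comp (C q * X) * h.denom = C μ * h.num * h.denom.comp (C q * X) := by
    apply RatFunc.algebraMap_injective k
    rw [map_mul, ← h1, hh, map_mul, map_mul, RatFunc.algebraMap_C]
    nth_rewrite 1 [← RatFunc.num_div_denom h]
    field_simp
  have hco := RatFunc.isCoprime_num_denom h
  have hdd : h.denom ∣ h.denom.comp (C q * X) := by
    have : h.denom ∣ h.num * (C μ * h.denom.comp (C q * X)) := ⟨h.num.comp (C q * X), by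
      linear_combination -h2⟩
    refine (hco.symm.dvd_of_dvd_mul_left this).trans ?_
    have hμ : μ ≠ 0 := by
      rintro rfl
      simp [h0] at hh
    exact (isUnit_C.2 hμ.isUnit).dvd_mul_left.1 dvd_rfl
  have hnn : h.num ∣ h.num.comp (C q * X) := by
    have : h.num ∣ h.num.comp (C q * X) * h.denom := ⟨C μ * h.denom.comp (C q * X), by
      linear_combination h2⟩
    exact hco.dvd_of_dvd_mul_right this
  have e1 := eq_C_mul_X_pow_of_dvd_comp hq0 hq hdd
  have e2 := eq_C_mul_X_pow_of_dvd_comp hq0 hq hnn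
  have e : h = RatFunc.C (h.num.leadingCoeff / h.denom.leadingCoeff) *
      RatFunc.X ^ ((h.num.natDegree : ℤ) - h.denom.natDegree) := by
    nth_rewrite 1 [← RatFunc.num_div_denom h]
    nth_rewrite 1 [e1, e2]
    simp [zpow_sub₀ (RatFunc.X_ne_zero (K := k)), RatFunc.algebraMap_C, RatFunc.algebraMap_X,
      mul_div_mul_comm]
  refine ⟨_, _, e, ?_⟩
  set m := (h.num.natDegree : ℤ) - h.denom.natDegree
  have h3 : τ h = RatFunc.C (q ^ m) * h := by
    rw [e, map_mul, map_zpow₀, hτ.map_C, hτ.map_X, mul_zpow, map_zpow₀ (RatFunc.C (K := k))]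
    ring
  exact RatFunc.C_injective (mul_right_cancel₀ h0 (h3.symm.trans hh))

theorem IsQShift.eq_C (hq0 : q ≠ 0)
    (hq : Function.Injective (fun n : ℕ => q ^ n))
    (hτ : IsQShift q τ)
    {h : RatFunc k} (hh : τ h = h) : ∃ c : k, h = RatFunc.C c := by
  rcases eq_or_ne h 0 with rfl | h0
  · exact ⟨0, by simp⟩
  obtain ⟨c, m, hc, hm⟩ := IsQShift.eq_C_mul_X_zpow hq0 hq hτ h0 (μ := 1) (by simpa using hh)
  have key : ∀ n : ℕ, q ^ n = 1 → n = 0 := fun n hn => hq (by simpa using hn)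
  have hm0 : m = 0 := by
    rcases Int.eq_nat_or_neg m with ⟨n, rfl | rfl⟩
    · simpa using key n (by simpa using hm)
    · simpa using key n (by simpa using hm)
  exact ⟨c, by simpa [hm0] using hc⟩

theorem IsQShift.eq_zero_of_eq_add (hq0 : q ≠ 0)
    (hq : Function.Injective (fun n : ℕ => q ^ n))
    (hτ : IsQShift q τ)
    {h : RatFunc k} {c : k} (hh : τ h = h + RatFunc.C c) : c = 0 := by
  have h1 := IsQShift.mul_comp_eq hτ h
  have hd : algebraMap k[X] (RatFunc k) h.denom ≠ 0 := by simpa using h.denom_ne_zero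
  have h2 : h.num.comp (C q * X) * h.denom =
      h.num * h.denom.comp (C q * X) + C c * h.denom * h.denom.comp (C q * X) := by
    apply RatFunc.algebraMap_injective k
    simp only [map_mul, map_add]
    rw [← h1, hh, RatFunc.algebraMap_C]
    nth_rewrite 1 [← RatFunc.num_div_denom h]
    field_simp
  have hco := RatFunc.isCoprime_num_denom h
  have hdd : h.denom ∣ h.denom.comp (C q * X) := by
    have : h.denom ∣ h.num * (h.denom.comp (C q * X)) :=
      ⟨h.num.comp (C q * X) - C c * h.denom.comp (C q * X), by linear_combination -h2⟩
    exact hco.symm.dvd_of_dvd_mul_left this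
  have e1 := eq_C_mul_X_pow_of_dvd_comp hq0 hq hdd
  rw [(RatFunc.monic_denom h).leadingCoeff, C_1, one_mul] at e1
  set m := h.denom.natDegree
  have e2 : h.denom.comp (C q * X) = C (q ^ m) * X ^ m := by
    rw [e1]; simp [mul_pow]
  have h3 : h.num.comp (C q * X) = C (q ^ m) * h.num + C (c * q ^ m) * X ^ m := by
    have hX : (X : k[X]) ^ m ≠ 0 := by simp
    apply mul_right_cancel₀ hX
    rw [e2, e1] at h2
    rw [h2, C_mul]
    ring
  have h4 := congrArg (fun p => p.coeff m) h3
  simp only [comp_C_mul_X_coeff, coeff_add, coeff_C_mul, coeff_X_pow_self, mul_one] at h4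
  have h5 : c * q ^ m = 0 := by linear_combination -h4
  exact (mul_eq_zero.1 h5).resolve_right (pow_ne_zero _ hq0)

theorem IsQShift.inftyValuation_apply [DecidableEq (RatFunc k)] (hq0 : q ≠ 0)
    (hτ : IsQShift q τ)
    (h : RatFunc k) : RatFunc.inftyValuation k (τ h) = RatFunc.inftyValuation k h := by
  have hp : ∀ p : k[X], RatFunc.inftyValuation k (τ (algebraMap k[X] _ p)) =
      RatFunc.inftyValuation k (algebraMap k[X] _ p) := fun p => by
    rcases eq_or_ne p 0 with rfl | h0
    · simp
    have hne : p.comp (C q * X) ≠ 0 := by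
      intro h
      have := congrArg (fun r => r.coeff p.natDegree) h
      simp [comp_C_mul_X_coeff, h0, hq0] at this
    rw [hτ p, RatFunc.inftyValuation_apply, RatFunc.inftyValuation_apply,
      RatFunc.inftyValuation.polynomial _ h0, RatFunc.inftyValuation.polynomial _ hne,
      natDegree_comp, natDegree_C_mul_X _ hq0, mul_one]
  rw [← RatFunc.num_div_denom h, map_div₀, map_div₀, map_div₀, hp, hp]
end

theorem IsAlgClosed.exists_algebraMap_eq_of_isIntegral {k F : Type*} [Field k] [Field F] [Algebra k F]
    [IsAlgClosed k] {u : F}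
    (hu : IsIntegral k u) : ∃ c : k, algebraMap k F c = u :=
  minpoly.mem_range_of_degree_eq_one k u
    (IsAlgClosed.degree_eq_one_of_irreducible k (minpoly.irreducible hu))

section
variable {k : Type*} [Field k] {q : k} {τ : RatFunc k ≃+* RatFunc k}

open Classical in
/-- The valuation ring of `k(t)` at infinity. -/
noncomputable def ringAtInfty (k : Type*) [Field k] : ValuationSubring (RatFunc k) :=
  (RatFunc.inftyValuation k).valuationSubring

open Classical in
theorem mem_ringAtInfty {h : RatFunc k} (h0 : h ≠ 0) : h ∈ ringAtInfty k ↔ h.intDegree ≤ 0 := by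
  rw [ringAtInfty, Valuation.mem_valuationSubring_iff, RatFunc.inftyValuation_apply,
    RatFunc.inftyValuation_of_nonzero _ h0, ← WithZero.exp_zero, WithZero.exp_le_exp]

theorem C_mem_ringAtInfty (c : k) : RatFunc.C c ∈ ringAtInfty k := by
  rcases eq_or_ne c 0 with rfl | hc
  · simp
  · rw [mem_ringAtInfty (by simpa)]
    simp

open Classical in
theorem IsQShift.mem_ringAtInfty (hq0 : q ≠ 0) (hτ : IsQShift q τ) {h : RatFunc k}
    (hh : h ∈ ringAtInfty k) : τ h ∈ ringAtInfty k := by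
  rw [ringAtInfty, Valuation.mem_valuationSubring_iff] at hh ⊢
  rwa [hτ.inftyValuation_apply hq0]

variable {F : Type*} [Field F] [Algebra (RatFunc k) F] {σ : F ≃+* F}

theorem IsQShift.isIntegral_ringAtInfty (hq0 : q ≠ 0) (hτ : IsQShift q τ)
    (hσ : ∀ x, σ (algebraMap (RatFunc k) F x) = algebraMap (RatFunc k) F (τ x)) {f : F}
    (hf : IsIntegral (ringAtInfty k) f) : IsIntegral (ringAtInfty k) (σ f) := by
  refine hf.map_of_comp_eq (((τ : RatFunc k →+* RatFunc k).comp
    (ringAtInfty k).subtype).codRestrict (ringAtInfty k)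
      fun x => hτ.mem_ringAtInfty hq0 x.2) (σ : F →+* F) ?_
  ext x
  exact (hσ x).symm

theorem IsQShift.isIntegral_polynomial [Algebra k[X] F] [IsScalarTower k[X] (RatFunc k) F]
    (hτ : IsQShift q τ)
    (hσ : ∀ x, σ (algebraMap (RatFunc k) F x) = algebraMap (RatFunc k) F (τ x)) {f : F}
    (hf : IsIntegral k[X] f) : IsIntegral k[X] (σ f) := by
  refine hf.map_of_comp_eq (compRingHom (C q * X)) (σ : F →+* F) ?_
  refine RingHom.ext fun p => ?_
  simp only [RingHom.comp_apply, RingHom.coe_coe,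
    IsScalarTower.algebraMap_apply k[X] (RatFunc k) F, hσ, hτ p, coe_compRingHom_apply]

theorem exists_isIntegral_ringAtInfty [FiniteDimensional (RatFunc k) F] (f : F) :
    ∃ m : ℕ, ∀ n, m ≤ n → IsIntegral (ringAtInfty k)
      (algebraMap (RatFunc k) F (RatFunc.X ^ n)⁻¹ * f) := by
  have hf : IsAlgebraic (ringAtInfty k) f :=
    (IsFractionRing.isAlgebraic_iff (ringAtInfty k) (RatFunc k) F).2
      (Algebra.IsAlgebraic.isAlgebraic f)
  obtain ⟨y, hy0, hy⟩ := hf.exists_integral_multiple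
  have hy0' : (y : RatFunc k) ≠ 0 := by simpa using hy0
  refine ⟨(-(y : RatFunc k).intDegree).toNat, fun n hn => ?_⟩
  have hX : (RatFunc.X ^ n : RatFunc k) ≠ 0 := pow_ne_zero _ RatFunc.X_ne_zero
  have hz : (RatFunc.X ^ n)⁻¹ * (y : RatFunc k)⁻¹ ∈ ringAtInfty k := by
    rw [mem_ringAtInfty (mul_ne_zero (inv_ne_zero hX) (inv_ne_zero hy0')),
      RatFunc.intDegree_mul (inv_ne_zero hX) (inv_ne_zero hy0'), RatFunc.intDegree_inv,
      RatFunc.intDegree_inv]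
    have : (RatFunc.X ^ n : RatFunc k).intDegree = n := by
      rw [← RatFunc.algebraMap_X, ← map_pow, RatFunc.intDegree_polynomial, natDegree_X_pow]
    omega
  have h1 := (isIntegral_algebraMap (R := ringAtInfty k) (A := F) (x := ⟨_, hz⟩)).mul hy
  rw [Algebra.smul_def] at h1
  change IsIntegral _ (algebraMap (RatFunc k) F ((RatFunc.X ^ n)⁻¹ * (y : RatFunc k)⁻¹) *
    (algebraMap (RatFunc k) F y * f)) at h1
  rwa [← mul_assoc, ← map_mul, inv_mul_cancel_right₀ hy0'] at h1

end

section
variable {k F : Type*} [Field k] [Field F] [Algebra k F] [Algebra (RatFunc k) F]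
  [IsScalarTower k (RatFunc k) F] {q : k} {τ : RatFunc k ≃+* RatFunc k} {σ : F ≃+* F}

/-- The constants of `σ` on `F` are the elements of `k`. -/
theorem IsQShift.exists_algebraMap_eq_of_fixed [IsAlgClosed k] [FiniteDimensional (RatFunc k) F]
    (hq0 : q ≠ 0) (hq : Function.Injective (fun n : ℕ => q ^ n)) (hτ : IsQShift q τ)
    (hσ : ∀ x, σ (algebraMap (RatFunc k) F x) = algebraMap (RatFunc k) F (τ x))
    {u : F} (hu : σ u = u) : ∃ c : k, algebraMap k F c = u := by
  have hint : IsIntegral (RatFunc k) u := Algebra.IsIntegral.isIntegral u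
  set P := minpoly (RatFunc k) u with hP
  have hmon : P.Monic := minpoly.monic hint
  have h1 : P.map (τ : RatFunc k →+* RatFunc k) = P := by
    refine minpoly.unique _ _ (hmon.map _) ?_ fun r hr hr0 => ?_
    · have h2 : (algebraMap (RatFunc k) F).comp (τ : RatFunc k →+* RatFunc k) =
          (σ : F →+* F).comp (algebraMap (RatFunc k) F) := RingHom.ext fun x => (hσ x).symm
      rw [aeval_def, eval₂_map, h2]
      have h3 := hom_eval₂ P (algebraMap (RatFunc k) F) (σ : F →+* F) u
      rw [← aeval_def, minpoly.aeval, map_zero] at h3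
      rw [RingHom.coe_coe, hu] at h3
      exact h3.symm
    · rw [degree_map]
      exact minpoly.min _ _ hr hr0
  have h2 : P ∈ lifts (RatFunc.C (K := k)) := by
    rw [lifts_iff_coeff_lifts]
    intro i
    have h3 := congrArg (fun p => p.coeff i) h1
    obtain ⟨c, hc⟩ := hτ.eq_C hq0 hq (h := P.coeff i) (by simpa using h3)
    exact ⟨c, hc.symm⟩
  obtain ⟨P0, hP0, -, hP0m⟩ := lifts_and_natDegree_eq_and_monic h2 hmon
  refine IsAlgClosed.exists_algebraMap_eq_of_isIntegral ⟨P0, hP0m, ?_⟩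
  have h4 : algebraMap k F = (algebraMap (RatFunc k) F).comp RatFunc.C :=
    IsScalarTower.algebraMap_eq k (RatFunc k) F
  rw [h4, ← eval₂_map, hP0, ← aeval_def, minpoly.aeval]

theorem IsQShift.map_algebraMap (hτ : IsQShift q τ)
    (hσ : ∀ x, σ (algebraMap (RatFunc k) F x) = algebraMap (RatFunc k) F (τ x)) (c : k) :
    σ (algebraMap k F c) = algebraMap k F c := by
  rw [IsScalarTower.algebraMap_apply k (RatFunc k) F, hσ, RatFunc.algebraMap_eq_C, hτ.map_C]

/-- An eigenvector of `σ` is a root of a monomial `c t ^ m`. -/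
theorem IsQShift.pow_finrank_eq [IsAlgClosed k] [FiniteDimensional (RatFunc k) F]
    (hq0 : q ≠ 0) (hq : Function.Injective (fun n : ℕ => q ^ n)) (hτ : IsQShift q τ)
    (hσ : ∀ x, σ (algebraMap (RatFunc k) F x) = algebraMap (RatFunc k) F (τ x))
    {f : F} {μ : k} (hf : σ f = algebraMap k F μ * f) :
    ∃ (c : k) (m : ℤ), f ^ Module.finrank (RatFunc k) F =
      algebraMap k F c * algebraMap (RatFunc k) F RatFunc.X ^ m := by
  rcases eq_or_ne f 0 with rfl | hf0
  · exact ⟨0, 0, by simp [(Module.finrank_pos (R := RatFunc k) (M := F)).ne']⟩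
  set N := Module.finrank (RatFunc k) F
  have h1 : τ (Algebra.norm (RatFunc k) f) =
      RatFunc.C (μ ^ N) * Algebra.norm (RatFunc k) f := by
    nth_rewrite 1 [Algebra.norm_eq_of_equiv_equiv τ σ (RingHom.ext fun x => (hσ x).symm) f]
    rw [hf, RingEquiv.apply_symm_apply, map_mul, IsScalarTower.algebraMap_apply k (RatFunc k) F,
      Algebra.norm_algebraMap, RatFunc.algebraMap_eq_C, map_pow RatFunc.C]
  obtain ⟨c, m, -, hm⟩ := hτ.eq_C_mul_X_zpow hq0 hq (by simpa [Algebra.norm_ne_zero_iff]) h1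
  set t := algebraMap (RatFunc k) F RatFunc.X with ht
  have ht0 : t ≠ 0 := by simp [ht, RatFunc.X_ne_zero]
  have hσt : σ t = algebraMap k F q * t := by
    rw [ht, hσ, hτ.map_X, map_mul, ← RatFunc.algebraMap_eq_C, ← IsScalarTower.algebraMap_apply]
  have hq' : algebraMap k F q ≠ 0 := by simpa
  obtain ⟨d, hd⟩ := hτ.exists_algebraMap_eq_of_fixed hq0 hq hσ (u := f ^ N * (t ^ m)⁻¹) (by
    rw [map_mul, map_pow, map_inv₀, map_zpow₀, hf, hσt, mul_pow, mul_zpow, ← map_pow, ← hm,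
      map_zpow₀]
    field_simp)
  exact ⟨d, m, by rw [hd]; field_simp⟩

/-- Generalized eigenvectors of `σ` are eigenvectors. -/
theorem IsQShift.eq_zero_of_map_eq_mul_add [CharZero k] [FiniteDimensional (RatFunc k) F]
    (hq0 : q ≠ 0) (hq : Function.Injective (fun n : ℕ => q ^ n)) (hτ : IsQShift q τ)
    (hσ : ∀ x, σ (algebraMap (RatFunc k) F x) = algebraMap (RatFunc k) F (τ x))
    {f g : F} {μ : k} (hf : σ f = algebraMap k F μ * f) (hg : σ g = algebraMap k F μ * g + f) :
    f = 0 := by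
  by_contra hf0
  have hμ : algebraMap k F μ ≠ 0 := by
    intro h
    rw [h, zero_mul, map_eq_zero_iff σ σ.injective] at hf
    exact hf0 hf
  have h1 : σ (g / f) = g / f + algebraMap k F μ⁻¹ := by
    rw [map_div₀, hf, hg, map_inv₀]
    field_simp
  have h2 : τ (Algebra.trace (RatFunc k) F (g / f)) = Algebra.trace (RatFunc k) F (g / f) +
      RatFunc.C (Module.finrank (RatFunc k) F * μ⁻¹) := by
    nth_rewrite 1 [Algebra.trace_eq_of_equiv_equiv τ σ (RingHom.ext fun x => (hσ x).symm) (g / f)]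
    rw [h1, RingEquiv.apply_symm_apply, map_add, IsScalarTower.algebraMap_apply k (RatFunc k) F,
      Algebra.trace_algebraMap, RatFunc.algebraMap_eq_C, nsmul_eq_mul, map_mul RatFunc.C,
      map_natCast]
  have h3 := hτ.eq_zero_of_eq_add hq0 hq h2
  have h4 : μ ≠ 0 := by rintro rfl; simp at hμ
  simp [h4, (Module.finrank_pos (R := RatFunc k) (M := F)).ne'] at h3

/-- The elements of `F` that are integral over `k[t]` and have poles of order at most `m`
at infinity. -/
noncomputable def boundedIntegral (k F : Type*) [Field k] [Field F] [Algebra k F]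
    [Algebra (RatFunc k) F] [IsScalarTower k (RatFunc k) F] [Algebra k[X] F]
    [IsScalarTower k[X] (RatFunc k) F] (m : ℕ) : Submodule k F where
  carrier := {f | IsIntegral k[X] f ∧ IsIntegral (ringAtInfty k)
    (algebraMap (RatFunc k) F (RatFunc.X ^ m)⁻¹ * f)}
  add_mem' ha hb := ⟨ha.1.add hb.1, by rw [mul_add]; exact ha.2.add hb.2⟩
  zero_mem' := ⟨isIntegral_zero, by rw [mul_zero]; exact isIntegral_zero⟩
  smul_mem' c f hf := by
    rw [← IsScalarTower.algebraMap_smul (RatFunc k) c f, Algebra.smul_def,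
      RatFunc.algebraMap_eq_C]
    refine ⟨?_, ?_⟩
    · rw [← RatFunc.algebraMap_C, ← IsScalarTower.algebraMap_apply]
      exact isIntegral_algebraMap.mul hf.1
    · rw [mul_left_comm]
      exact (isIntegral_algebraMap (R := ringAtInfty k)
        (x := ⟨_, C_mem_ringAtInfty c⟩)).mul hf.2

theorem mem_boundedIntegral [Algebra k[X] F] [IsScalarTower k[X] (RatFunc k) F] {m : ℕ} {f : F} :
    f ∈ boundedIntegral k F m ↔ IsIntegral k[X] f ∧ IsIntegral (ringAtInfty k)
      (algebraMap (RatFunc k) F (RatFunc.X ^ m)⁻¹ * f) := Iff.rfl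

theorem trace_mem_map_degreeLE [FiniteDimensional (RatFunc k) F] [Algebra k[X] F]
    [IsScalarTower k[X] (RatFunc k) F] {m : ℕ} {f : F} (hf : f ∈ boundedIntegral k F m) :
    Algebra.trace (RatFunc k) F f ∈
      (degreeLE k m).map (IsScalarTower.toAlgHom k k[X] (RatFunc k)).toLinearMap := by
  have h1 := Algebra.isIntegral_trace (L := RatFunc k) hf.1
  have h2 := Algebra.isIntegral_trace (L := RatFunc k) hf.2
  rw [← Algebra.smul_def, map_smul, smul_eq_mul] at h2
  obtain ⟨p, hp⟩ := IsIntegrallyClosed.isIntegral_iff.1 h1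
  obtain ⟨r, hr⟩ := IsIntegrallyClosed.isIntegral_iff.1 h2
  refine ⟨p, ?_, hp⟩
  rw [SetLike.mem_coe, mem_degreeLE]
  rcases eq_or_ne p 0 with rfl | hp0
  · simp
  refine degree_le_of_natDegree_le ?_
  have hX : (RatFunc.X ^ m : RatFunc k) ≠ 0 := pow_ne_zero _ RatFunc.X_ne_zero
  have hp0' : algebraMap k[X] (RatFunc k) p ≠ 0 := by simpa
  have h3 : (RatFunc.X ^ m)⁻¹ * algebraMap k[X] (RatFunc k) p ∈ ringAtInfty k := by
    rw [hp, ← hr]; exact r.2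
  rw [mem_ringAtInfty (mul_ne_zero (inv_ne_zero hX) hp0'),
      RatFunc.intDegree_mul (inv_ne_zero hX) hp0', RatFunc.intDegree_inv,
      RatFunc.intDegree_polynomial, ← RatFunc.algebraMap_X, ← map_pow,
      RatFunc.intDegree_polynomial, natDegree_X_pow] at h3
  omega

theorem mul_mem_boundedIntegral [Algebra k[X] F] [IsScalarTower k[X] (RatFunc k) F] {m n : ℕ}
    {f g : F} (hf : f ∈ boundedIntegral k F m) (hg : g ∈ boundedIntegral k F n) :
    f * g ∈ boundedIntegral k F (m + n) := by
  refine ⟨hf.1.mul hg.1, ?_⟩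
  rw [pow_add, mul_inv, map_mul, mul_mul_mul_comm]
  exact hf.2.mul hg.2

instance [CharZero k] [FiniteDimensional (RatFunc k) F] [Algebra k[X] F]
    [IsScalarTower k[X] (RatFunc k) F] (m : ℕ) :
    FiniteDimensional k (boundedIntegral k F m) := by
  obtain ⟨s, b, hb⟩ := FiniteDimensional.exists_is_basis_integral k[X] (RatFunc k) F
  choose M hM using fun i => exists_isIntegral_ringAtInfty (k := k) (b i)
  have hb' : ∀ i, b i ∈ boundedIntegral k F (∑ j, M j) := fun i =>
    ⟨hb i, hM i _ (Finset.single_le_sum (f := M) (fun _ _ => Nat.zero_le _) (Finset.mem_univ i))⟩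
  let D : Submodule k (RatFunc k) := (degreeLE k ((m + ∑ j, M j : ℕ) : WithBot ℕ)).map
    (IsScalarTower.toAlgHom k k[X] (RatFunc k)).toLinearMap
  have : FiniteDimensional k D := by
    have : FiniteDimensional k (degreeLE k ((m + ∑ j, M j : ℕ) : WithBot ℕ)) := by
      classical
      rw [degreeLE_eq_span_X_pow]
      infer_instance
    infer_instance
  let Φ (i : s) : boundedIntegral k F m →ₗ[k] D :=
    LinearMap.codRestrict D (((Algebra.trace (RatFunc k) F).restrictScalars k).comp
      ((LinearMap.mulRight k (b i)).comp (boundedIntegral k F m).subtype))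
      fun f => trace_mem_map_degreeLE (mul_mem_boundedIntegral f.2 (hb' i))
  refine Module.Finite.of_injective (LinearMap.pi Φ) ?_
  rw [← LinearMap.ker_eq_bot, LinearMap.ker_eq_bot']
  intro f hf
  have h1 : ∀ i, Algebra.trace (RatFunc k) F (f * b i) = 0 := fun i =>
    congrArg Subtype.val (congrFun hf i)
  have h2 : Algebra.traceForm (RatFunc k) F (f : F) = 0 := b.ext h1
  ext
  exact (traceForm_nondegenerate (RatFunc k) F).1 _ fun y => by rw [h2]; rfl

theorem IsQShift.map_mem_boundedIntegral [Algebra k[X] F] [IsScalarTower k[X] (RatFunc k) F]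
    (hq0 : q ≠ 0) (hτ : IsQShift q τ)
    (hσ : ∀ x, σ (algebraMap (RatFunc k) F x) = algebraMap (RatFunc k) F (τ x)) {m : ℕ} {f : F}
    (hf : f ∈ boundedIntegral k F m) : σ f ∈ boundedIntegral k F m := by
  refine ⟨hτ.isIntegral_polynomial hσ hf.1, ?_⟩
  have h1 := (isIntegral_algebraMap (R := ringAtInfty k) (A := F)
    (x := ⟨_, C_mem_ringAtInfty (q ^ m)⟩)).mul (hτ.isIntegral_ringAtInfty hq0 hσ hf.2)
  change IsIntegral _ (algebraMap (RatFunc k) F (RatFunc.C (q ^ m)) * _) at h1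
  have hqm : RatFunc.C q ^ m ≠ 0 := by simpa using fun h => absurd h hq0
  rwa [map_mul, hσ, map_inv₀ τ, map_pow τ, hτ.map_X, ← mul_assoc, ← map_mul, map_pow RatFunc.C,
    mul_pow, mul_inv, mul_inv_cancel_left₀ hqm] at h1

theorem IsQShift.mem_span_eigenvectors [IsAlgClosed k] [CharZero k]
    [FiniteDimensional (RatFunc k) F] [Algebra k[X] F] [IsScalarTower k[X] (RatFunc k) F]
    (hq0 : q ≠ 0) (hq : Function.Injective (fun n : ℕ => q ^ n)) (hτ : IsQShift q τ)
    (hσ : ∀ x, σ (algebraMap (RatFunc k) F x) = algebraMap (RatFunc k) F (τ x)) {m : ℕ} {f : F}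
    (hf : f ∈ boundedIntegral k F m) :
    f ∈ Submodule.span k {e : F | ∃ μ : k, σ e = algebraMap k F μ * e} := by
  set W := boundedIntegral k F m
  let T : Module.End k W :=
    { toFun := fun w => ⟨σ w, hτ.map_mem_boundedIntegral hq0 hσ w.2⟩
      map_add' := fun a b => Subtype.ext (map_add σ _ _)
      map_smul' := fun c a => Subtype.ext <| by
        simp [Algebra.smul_def, hτ.map_algebraMap hσ] }
  have hT : ∀ w : W, ((T w : W) : F) = σ w := fun w => rfl
  have hstep : ∀ (μ : k) (w : W), (T - μ • 1) ((T - μ • 1) w) = 0 → (T - μ • 1) w = 0 := by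
    intro μ w hw
    have h1 : ∀ v : W, (((T - μ • 1) v : W) : F) = σ v - algebraMap k F μ * v := fun v => by
      simp [hT, Algebra.smul_def]
    have h2 := congrArg Subtype.val hw
    rw [h1] at h2
    ext
    refine hτ.eq_zero_of_map_eq_mul_add hq0 hq hσ (g := w) (sub_eq_zero.1 h2) ?_
    rw [h1]
    ring
  have hgen : ∀ μ, T.maxGenEigenspace μ ≤
      (Submodule.span k {e : F | ∃ μ : k, σ e = algebraMap k F μ * e}).comap W.subtype := by
    intro μ w hw
    obtain ⟨j, hj⟩ := (Module.End.mem_maxGenEigenspace _ _ _).1 hw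
    have h1 : (T - μ • 1) w = 0 := by
      induction j with
      | zero => rw [pow_zero, Module.End.one_apply] at hj; rw [hj, map_zero]
      | succ j ih =>
        rcases j with _ | j
        · simpa using hj
        · apply ih
          rw [pow_succ', Module.End.mul_apply]
          rw [pow_succ', pow_succ', Module.End.mul_apply, Module.End.mul_apply] at hj
          exact hstep μ _ hj
    refine Submodule.subset_span ⟨μ, ?_⟩
    have h2 := congrArg Subtype.val h1
    simpa [hT, Algebra.smul_def, sub_eq_zero] using h2
  have htop := iSup_le hgen
  rw [Module.End.iSup_maxGenEigenspace_eq_top] at htop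
  exact htop (Submodule.mem_top (x := (⟨f, hf⟩ : W)))

end

theorem RingHom.surjective_of_comp_algebraMap {K F : Type*} [Field K] [Field F] [Algebra K F]
    [FiniteDimensional K F] (τ : K ≃+* K) (s : F →+* F)
    (hs : ∀ x, s (algebraMap K F x) = algebraMap K F (τ x)) : Function.Surjective s := by
  let E : IntermediateField K F := s.fieldRange.toIntermediateField fun x =>
    ⟨algebraMap K F (τ.symm x), by rw [hs, τ.apply_symm_apply]⟩
  let e : F ≃+* E := RingEquiv.ofBijective (s.codRestrict E fun x => ⟨x, rfl⟩)
    ⟨fun x y h => s.injective (congrArg Subtype.val h), fun ⟨y, x, hx⟩ => ⟨x, Subtype.ext hx⟩⟩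
  have h1 : Module.finrank K F = Module.finrank K E :=
    Algebra.finrank_eq_of_equiv_equiv τ e (RingHom.ext fun x => Subtype.ext (hs x).symm)
  have h2 : E = ⊤ := IntermediateField.eq_of_le_of_finrank_eq le_top
    (by rw [IntermediateField.finrank_top', h1])
  intro y
  have h3 : y ∈ E := h2 ▸ IntermediateField.mem_top
  exact h3

theorem exists_isQShift {k : Type*} [Field k] {q : k} (hq0 : q ≠ 0) :
    ∃ τ : RatFunc k ≃+* RatFunc k, IsQShift q τ := by
  let := invertibleOfNonzero hq0
  refine ⟨IsFractionRing.ringEquivOfRingEquiv (algEquivCMulXAddC q 0).toRingEquiv, fun p => ?_⟩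
  rw [IsFractionRing.ringEquivOfRingEquiv_algebraMap]
  simp [comp, aeval_def, algebraMap_eq]

theorem IsQShift.map_algebraMap_eq {k Ω : Type*} [Field k] [Field Ω] [Algebra (RatFunc k) Ω]
    {q : k} {τ : RatFunc k ≃+* RatFunc k} (hτ : IsQShift q τ) (σ : Ω ≃+* Ω)
    (hσk : ∀ a : k, σ (algebraMap (RatFunc k) Ω (RatFunc.C a)) =
      algebraMap (RatFunc k) Ω (RatFunc.C a))
    (hσt : σ (algebraMap (RatFunc k) Ω RatFunc.X) =
      algebraMap (RatFunc k) Ω (RatFunc.C q) * algebraMap (RatFunc k) Ω RatFunc.X)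
    (x : RatFunc k) : σ (algebraMap (RatFunc k) Ω x) = algebraMap (RatFunc k) Ω (τ x) := by
  have h : (σ : Ω →+* Ω).comp (algebraMap (RatFunc k) Ω) =
      (algebraMap (RatFunc k) Ω).comp (τ : RatFunc k →+* RatFunc k) := by
    refine IsLocalization.ringHom_ext (nonZeroDivisors k[X]) (Polynomial.ringHom_ext ?_ ?_)
    · intro a
      simp [RatFunc.algebraMap_C, hσk, hτ.map_C]
    · simp [RatFunc.algebraMap_X, hσt, hτ.map_X]
  exact RingHom.congr_fun h x

/-- A solution of a linear recurrence lies in a finite extension stable under the shift. -/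
theorem exists_finiteDimensional_stable {K Ω : Type*} [Field K] [Field Ω] [Algebra K Ω]
    [Algebra.IsAlgebraic K Ω] (τ : K ≃+* K) (σ : RingAut Ω)
    (hσ : ∀ x, σ (algebraMap K Ω x) = algebraMap K Ω (τ x)) (α : Ω)
    (n : ℕ) (a : Fin (n + 1) → K) (ha : a ≠ 0)
    (hrec : ∑ i : Fin (n + 1), algebraMap K Ω (a i) * (σ ^ i.val) α = 0) :
    ∃ E : IntermediateField K Ω, FiniteDimensional K E ∧ α ∈ E ∧ ∀ x ∈ E, σ x ∈ E := by
  classical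
  obtain ⟨d, hd, hmax⟩ : ∃ d, a d ≠ 0 ∧ ∀ i, d < i → a i = 0 := by
    have hne : (Finset.univ.filter fun i => a i ≠ 0).Nonempty := by
      obtain ⟨i, hi⟩ := Function.ne_iff.1 ha
      exact ⟨i, by simpa using hi⟩
    refine ⟨_, (Finset.mem_filter.1 (Finset.max'_mem _ hne)).2, fun i hi => ?_⟩
    by_contra h
    exact absurd (Finset.le_max' _ i (by simpa using h)) (not_le.2 hi)
  set S : Set Ω := (fun i : ℕ => (σ ^ i) α) '' Set.Iio d.val with hS
  let E := IntermediateField.adjoin K S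
  have hgen : ∀ i < d.val, (σ ^ i) α ∈ E := fun i hi =>
    IntermediateField.subset_adjoin K S ⟨i, hi, rfl⟩
  have htop : (σ ^ d.val) α ∈ E := by
    rw [← Finset.add_sum_erase _ _ (Finset.mem_univ d)] at hrec
    have hd' : algebraMap K Ω (a d) ≠ 0 := by simpa
    have h1 : (σ ^ d.val) α = -(algebraMap K Ω (a d))⁻¹ *
        ∑ i ∈ Finset.univ.erase d, algebraMap K Ω (a i) * (σ ^ i.val) α := by
      rw [eq_neg_of_add_eq_zero_right hrec]
      field_simp
    rw [h1]
    refine mul_mem (neg_mem (inv_mem (E.algebraMap_mem _))) (sum_mem fun i hi => ?_)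
    rcases lt_or_gt_of_ne (Finset.ne_of_mem_erase hi) with h | h
    · exact mul_mem (E.algebraMap_mem _) (hgen _ h)
    · rw [hmax i h, map_zero, zero_mul]
      exact zero_mem _
  refine ⟨E, ?_, ?_, ?_⟩
  · have : Finite S := ((Set.finite_Iio d.val).image _).to_subtype
    exact IntermediateField.finiteDimensional_adjoin fun x _ => Algebra.IsIntegral.isIntegral x
  · rcases Nat.eq_zero_or_pos d.val with h | h
    · simpa [h] using htop
    · simpa using hgen 0 h
  · intro x hx
    induction hx using IntermediateField.adjoin_induction with
    | mem x hx =>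
      obtain ⟨i, hi, rfl⟩ := hx
      have h1 : σ ((σ ^ i) α) = (σ ^ (i + 1)) α := by rw [pow_succ']; rfl
      simp only [h1]
      rcases (Nat.succ_le_of_lt hi).lt_or_eq with h | h
      · exact hgen _ h
      · rw [Nat.succ_eq_add_one] at h
        rwa [h]
    | algebraMap x => rw [hσ]; exact E.algebraMap_mem _
    | add x y _ _ hx hy => rw [map_add]; exact add_mem hx hy
    | inv x _ hx => rw [map_inv₀]; exact inv_mem hx
    | mul x y _ _ hx hy => rw [map_mul]; exact mul_mem hx hy

/-- Proposition 3.3: let `k` be algebraically closed of characteristic zero, `q ∈ k` not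
a root of unity, and `σ` an extension to the algebraic closure of `k(t)` of the `q`-shift
automorphism `t ↦ qt` of `k(t)`.  If `α`, algebraic over `k(t)`, satisfies a nonzero
linear `q`-recurrence `∑ a_i · σ^i(α) = 0` with coefficients `a_i ∈ k(t)`, then
`α ∈ k(t^{1/n})` for some positive integer `n`, i.e. `α` lies in the subfield generated
by `k` and an `n`-th root `s` of `t`. -/
theorem stmt8 {k : Type*} [Field k] [CharZero k] [IsAlgClosed k]
    (q : k) (hq0 : q ≠ 0) (hq : ∀ n : ℕ, 0 < n → q ^ n ≠ 1)
    (σ : RingAut (AlgebraicClosure (RatFunc k)))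
    (hσk : ∀ a : k, σ (algebraMap (RatFunc k) (AlgebraicClosure (RatFunc k)) (RatFunc.C a))
      = algebraMap (RatFunc k) (AlgebraicClosure (RatFunc k)) (RatFunc.C a))
    (hσt : σ (algebraMap (RatFunc k) (AlgebraicClosure (RatFunc k)) RatFunc.X)
      = algebraMap (RatFunc k) (AlgebraicClosure (RatFunc k)) (RatFunc.C q) *
        algebraMap (RatFunc k) (AlgebraicClosure (RatFunc k)) RatFunc.X)
    (α : AlgebraicClosure (RatFunc k))
    (n : ℕ) (a : Fin (n + 1) → RatFunc k) (ha : a ≠ 0)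
    (hrec : ∑ i : Fin (n + 1),
      algebraMap (RatFunc k) (AlgebraicClosure (RatFunc k)) (a i) * (σ ^ i.val) α = 0) :
    ∃ (N : ℕ), 0 < N ∧ ∃ s : AlgebraicClosure (RatFunc k),
      s ^ N = algebraMap (RatFunc k) (AlgebraicClosure (RatFunc k)) RatFunc.X ∧
      α ∈ Subfield.closure
        (Set.range (fun a : k =>
          algebraMap (RatFunc k) (AlgebraicClosure (RatFunc k)) (RatFunc.C a)) ∪ {s}) := by
  obtain ⟨τ, hτ⟩ := exists_isQShift hq0
  have hq' := pow_injective_of_forall_ne_one hq0 hq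
  have hσ := hτ.map_algebraMap_eq σ hσk hσt
  obtain ⟨E, _, hα, hE⟩ := exists_finiteDimensional_stable τ σ hσ α n a ha hrec
  let s₀ : E →+* E := ((σ : AlgebraicClosure (RatFunc k) →+* _).comp
    (algebraMap E (AlgebraicClosure (RatFunc k)))).codRestrict E fun x => hE x x.2
  have hs₀ : ∀ x, s₀ (algebraMap (RatFunc k) E x) = algebraMap (RatFunc k) E (τ x) := fun x =>
    Subtype.ext (hσ x)
  let σE : E ≃+* E := RingEquiv.ofBijective s₀
    ⟨s₀.injective, RingHom.surjective_of_comp_algebraMap τ s₀ hs₀⟩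
  have hσE : ∀ x, σE (algebraMap (RatFunc k) E x) = algebraMap (RatFunc k) E (τ x) := hs₀
  have hN : 0 < Module.finrank (RatFunc k) E := Module.finrank_pos
  refine ⟨Module.finrank (RatFunc k) E, hN, ?_⟩
  obtain ⟨s, hs⟩ := IsAlgClosed.exists_pow_nat_eq
    (algebraMap (RatFunc k) (AlgebraicClosure (RatFunc k)) RatFunc.X) hN
  refine ⟨s, hs, ?_⟩
  set S := Subfield.closure (Set.range (fun a : k =>
    algebraMap (RatFunc k) (AlgebraicClosure (RatFunc k)) (RatFunc.C a)) ∪ {s})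
  have hsS : s ∈ S := Subfield.subset_closure (Or.inr rfl)
  have hCS : ∀ c : k, algebraMap k (AlgebraicClosure (RatFunc k)) c ∈ S := fun c => by
    rw [IsScalarTower.algebraMap_apply k (RatFunc k), RatFunc.algebraMap_eq_C]
    exact Subfield.subset_closure (Or.inl ⟨c, rfl⟩)
  have hpS : ∀ p : k[X], algebraMap k[X] (AlgebraicClosure (RatFunc k)) p ∈ S := fun p => by
    induction p using Polynomial.induction_on' with
    | add p r hp hr => rw [map_add]; exact add_mem hp hr
    | monomial i c =>
      rw [IsScalarTower.algebraMap_apply k[X] (RatFunc k), ← C_mul_X_pow_eq_monomial, map_mul,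
        map_pow, RatFunc.algebraMap_X, RatFunc.algebraMap_C, map_mul, map_pow, ← hs]
      exact mul_mem (Subfield.subset_closure (Or.inl ⟨c, rfl⟩)) (pow_mem (pow_mem hsS _) _)
  have hs0 : s ≠ 0 := by
    rintro rfl
    rw [zero_pow hN.ne', eq_comm, map_eq_zero_iff _ (algebraMap (RatFunc k) _).injective] at hs
    exact RatFunc.X_ne_zero hs
  have heig : ∀ e : E, (∃ μ : k, σE e = algebraMap k E μ * e) →
      (e : AlgebraicClosure (RatFunc k)) ∈ S := by
    rintro e ⟨μ, he⟩
    obtain ⟨c, m, hcm⟩ := hτ.pow_finrank_eq hq0 hq' hσE he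
    have h1 : (e : AlgebraicClosure (RatFunc k)) ^ Module.finrank (RatFunc k) E =
        algebraMap k (AlgebraicClosure (RatFunc k)) c *
          algebraMap (RatFunc k) (AlgebraicClosure (RatFunc k)) RatFunc.X ^ m := by
      have := congrArg (algebraMap E (AlgebraicClosure (RatFunc k))) hcm
      rw [map_pow, map_mul, map_zpow₀] at this
      exact this
    obtain ⟨c', hc'⟩ := IsAlgClosed.exists_algebraMap_eq_of_isIntegral
      (u := (e : AlgebraicClosure (RatFunc k)) * (s ^ m)⁻¹) (k := k) (by
        refine IsIntegral.of_pow hN ?_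
        have h2 : ((e : AlgebraicClosure (RatFunc k)) * (s ^ m)⁻¹) ^
            Module.finrank (RatFunc k) E = algebraMap k _ c := by
          rw [mul_pow, h1, ← hs, inv_pow, ← zpow_natCast (s ^ m), ← zpow_natCast s, ← zpow_mul,
            ← zpow_mul, mul_comm m, mul_inv_cancel_right₀ (zpow_ne_zero _ hs0)]
        rw [h2]
        exact isIntegral_algebraMap)
    have h3 : (e : AlgebraicClosure (RatFunc k)) = algebraMap k _ c' * s ^ m := by
      rw [hc', inv_mul_cancel_right₀ (zpow_ne_zero _ hs0)]
    rw [h3]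
    exact mul_mem (hCS _) (zpow_mem hsS _)
  have halg : IsAlgebraic k[X] (⟨α, hα⟩ : E) :=
    (IsFractionRing.isAlgebraic_iff k[X] (RatFunc k) E).2 (Algebra.IsAlgebraic.isAlgebraic _)
  obtain ⟨p, hp0, hp⟩ := halg.exists_integral_multiple
  obtain ⟨m, hm⟩ := exists_isIntegral_ringAtInfty (k := k) (p • (⟨α, hα⟩ : E))
  have hspan := hτ.mem_span_eigenvectors hq0 hq' hσE (f := p • (⟨α, hα⟩ : E)) (m := m)
    ⟨hp, hm m le_rfl⟩
  have hpα : algebraMap k[X] (AlgebraicClosure (RatFunc k)) p * α ∈ S := by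
    have key : ∀ x ∈ Submodule.span k {e : E | ∃ μ : k, σE e = algebraMap k E μ * e},
        (x : AlgebraicClosure (RatFunc k)) ∈ S := fun x hx => by
      induction hx using Submodule.span_induction with
      | mem x hx => exact heig x hx
      | zero => exact zero_mem S
      | add x y _ _ hx hy => exact add_mem hx hy
      | smul c x _ hx =>
        rw [Algebra.smul_def (A := E) c x]
        exact mul_mem (hCS c) hx
    have h1 := key _ hspan
    rw [Algebra.smul_def] at h1
    exact h1
  have hp0' : algebraMap k[X] (AlgebraicClosure (RatFunc k)) p ≠ 0 := by
    rw [IsScalarTower.algebraMap_apply k[X] (RatFunc k)]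
    simpa using hp0
  have h1 := mul_mem (inv_mem (hpS p)) hpα
  rwa [inv_mul_cancel_left₀ hp0'] at h1
end

section
/- Let k be algebraically closed of characteristic zero. If α in the algebraic closure of k(t) satisfies α(t+n) - α(t) = m for some nonzero integer n and integer m, then α = (m/n)t + c for some c ∈ k. -/
open Polynomial in
theorem Polynomial.aevalAeval_eq_eval₂ {R A : Type*} [CommSemiring R] [CommSemiring A]
    [Algebra R A] (x y : A) (p : R[X][X]) :
    aevalAeval x y p = p.eval₂ (aeval x : R[X] →ₐ[R] A).toRingHom y := by
  induction p using Polynomial.induction_on' with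
  | add p q hp hq => rw [map_add, eval₂_add, hp, hq]
  | monomial n a => simp

open Polynomial in
theorem AlgHom.map_aevalAeval {R A B : Type*} [CommSemiring R] [CommSemiring A] [CommSemiring B]
    [Algebra R A] [Algebra R B] (f : A →ₐ[R] B) (x y : A) (p : R[X][X]) :
    f (aevalAeval x y p) = aevalAeval (f x) (f y) p := by
  have h : f.comp (aevalAeval x y) = aevalAeval (f x) (f y) := by
    ext <;> simp
  exact DFunLike.congr_fun h p

open Polynomial in
/-- If `y` satisfies a nontrivial polynomial relation with infinitely many elements `x`, then `y`
is algebraic. -/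
theorem isAlgebraic_of_infinite_setOf_aevalAeval_eq_zero {R A : Type*} [CommRing R] [CommRing A]
    [IsDomain A] [Algebra R A] {y : A} {p : R[X][X]} (hp : p ≠ 0)
    (h : {x : A | aevalAeval x y p = 0}.Infinite) : IsAlgebraic R y := by
  have hq : (Bivariate.swap p).map (aeval y : R[X] →ₐ[R] A).toRingHom = 0 := by
    refine eq_zero_of_infinite_isRoot _ (h.mono fun x hx ↦ ?_)
    rw [Set.mem_ofPred_eq, IsRoot.def, eval_map, ← aevalAeval_eq_eval₂,
      Bivariate.aevalAeval_swap]
    exact hx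
  have hs : Bivariate.swap p ≠ 0 := by simpa using hp
  obtain ⟨i, hi⟩ : ∃ i, (Bivariate.swap p).coeff i ≠ 0 := by
    by_contra! hc
    exact hs (Polynomial.ext hc)
  exact ⟨_, hi, by simpa using congr_arg (coeff · i) hq⟩

open Polynomial in
/-- An element which is algebraically dependent with `x` and fixed by an endomorphism translating
`x` by a nonzero integer is algebraic over the base ring. -/
theorem AlgHom.isAlgebraic_of_apply_eq_self {R A : Type*} [CommRing R] [CommRing A]
    [IsDomain A] [CharZero A] [Algebra R A] (f : A →ₐ[R] A) {x y : A} {n : ℤ} (hn : n ≠ 0)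
    (hx : f x = x + n) (hy : f y = y) {p : R[X][X]} (hp : p ≠ 0)
    (h : aevalAeval x y p = 0) : IsAlgebraic R y := by
  refine isAlgebraic_of_infinite_setOf_aevalAeval_eq_zero hp ?_
  have hroot (i : ℕ) : aevalAeval (x + i * n) y p = 0 := by
    induction i with
    | zero => simpa using h
    | succ i ih =>
      have := f.map_aevalAeval (x + i * n) y p
      rw [ih, map_zero, hy, map_add, map_mul, map_natCast, map_intCast, hx] at this
      rw [this]
      congr 2
      push_cast
      ring
  refine Set.infinite_of_injective_forall_mem (f := fun i : ℕ ↦ x + i * n) (fun i j hij ↦ ?_) hroot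
  simpa [hn] using hij

theorem RingAut.zpow_apply_eq_add_zsmul {A : Type*} [Ring A] (σ : RingAut A) {x c : A}
    (hx : σ x = x + c) (hc : σ c = c) (n : ℤ) : (σ ^ n) x = x + n * c := by
  have hnat (σ : RingAut A) {c : A} (hx : σ x = x + c) (hc : σ c = c) (i : ℕ) :
      (σ ^ i) x = x + i * c := by
    induction i with
    | zero => simp
    | succ i ih =>
      rw [pow_succ', RingAut.mul_apply, ih, map_add, map_mul, map_natCast, hx, hc]
      push_cast
      noncomm_ring
  have hc' : σ⁻¹ c = c := (RingEquiv.symm_apply_eq σ).2 hc.symm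
  have hx' : σ⁻¹ x = x + -c := by
    refine (RingEquiv.symm_apply_eq σ).2 ?_
    rw [map_add, map_neg, hx, hc]
    abel
  obtain ⟨i, rfl | rfl⟩ := n.eq_nat_or_neg
  · simpa using hnat σ hx hc i
  · rw [zpow_neg, zpow_natCast, ← inv_pow, hnat _ hx' (by rw [map_neg, hc'])]
    simp

/-- Lemma 3.7: let `k` be algebraically closed of characteristic zero and `σ` an
extension to the algebraic closure of `k(t)` of the shift automorphism `t ↦ t+1` of
`k(t)`.  If `σ^n α - α = m` for some nonzero integer `n` and integer `m`, then
`α = (m/n)·t + c` for some `c ∈ k`. -/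
theorem stmt13 {k : Type*} [Field k] [CharZero k] [IsAlgClosed k]
    (σ : RingAut (AlgebraicClosure (RatFunc k)))
    (hσk : ∀ a : k, σ (algebraMap (RatFunc k) (AlgebraicClosure (RatFunc k)) (RatFunc.C a))
      = algebraMap (RatFunc k) (AlgebraicClosure (RatFunc k)) (RatFunc.C a))
    (hσt : σ (algebraMap (RatFunc k) (AlgebraicClosure (RatFunc k)) RatFunc.X)
      = algebraMap (RatFunc k) (AlgebraicClosure (RatFunc k)) RatFunc.X + 1)
    (α : AlgebraicClosure (RatFunc k)) (n : ℤ) (hn : n ≠ 0) (m : ℤ)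
    (hα : (σ ^ n) α - α = (m : AlgebraicClosure (RatFunc k))) :
    ∃ c : k, α = ((m : AlgebraicClosure (RatFunc k)) / (n : AlgebraicClosure (RatFunc k))) *
        algebraMap (RatFunc k) (AlgebraicClosure (RatFunc k)) RatFunc.X +
      algebraMap (RatFunc k) (AlgebraicClosure (RatFunc k)) (RatFunc.C c) := by
  have hn' : (n : AlgebraicClosure (RatFunc k)) ≠ 0 := Int.cast_ne_zero.2 hn
  have hC (a : k) : algebraMap (RatFunc k) (AlgebraicClosure (RatFunc k)) (RatFunc.C a) =
      algebraMap k (AlgebraicClosure (RatFunc k)) a := by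
    rw [IsScalarTower.algebraMap_apply k (RatFunc k), RatFunc.algebraMap_eq_C]
  set t := algebraMap (RatFunc k) (AlgebraicClosure (RatFunc k)) RatFunc.X with ht
  have hτt : (σ ^ n) t = t + n := by
    simpa using RingAut.zpow_apply_eq_add_zsmul σ hσt (map_one σ) n
  have hτk (a : k) : (σ ^ n) (algebraMap k (AlgebraicClosure (RatFunc k)) a) =
      algebraMap k (AlgebraicClosure (RatFunc k)) a := by
    have h : σ (algebraMap k (AlgebraicClosure (RatFunc k)) a) =
        algebraMap k (AlgebraicClosure (RatFunc k)) a + 0 := by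
      rw [← hC, hσk, add_zero]
    simpa using RingAut.zpow_apply_eq_add_zsmul σ h (map_zero σ) n
  let f : AlgebraicClosure (RatFunc k) →ₐ[k] AlgebraicClosure (RatFunc k) :=
    { (σ ^ n : RingAut _).toRingHom with commutes' := hτk }
  have hfix : f (α - m / n * t) = α - m / n * t := by
    have h : (σ ^ n) α = α + m := by rw [← hα]; ring
    change (σ ^ n) (α - m / n * t) = _
    rw [map_sub, map_mul, map_div₀, map_intCast, map_intCast, h, hτt]
    field_simp
    ring
  obtain ⟨p, hp, hp0⟩ := (IsFractionRing.isAlgebraic_iff (Polynomial k) (RatFunc k)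
    (AlgebraicClosure (RatFunc k))).2
      (Algebra.IsAlgebraic.isAlgebraic (R := RatFunc k) (α - m / n * t))
  have hmap : algebraMap (Polynomial k) (AlgebraicClosure (RatFunc k)) =
      (Polynomial.aeval t : Polynomial k →ₐ[k] _).toRingHom := by
    ext a
    · simp [IsScalarTower.algebraMap_apply (Polynomial k) (RatFunc k)
        (AlgebraicClosure (RatFunc k)), hC]
    · simp [IsScalarTower.algebraMap_apply (Polynomial k) (RatFunc k)
        (AlgebraicClosure (RatFunc k)), ht]
  rw [Polynomial.aeval_def, hmap, ← Polynomial.aevalAeval_eq_eval₂] at hp0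
  have halg : IsAlgebraic k (α - m / n * t) :=
    f.isAlgebraic_of_apply_eq_self hn hτt hfix hp hp0
  obtain ⟨c, hc⟩ := minpoly.mem_range_of_degree_eq_one k _
    (IsAlgClosed.degree_eq_one_of_irreducible k (minpoly.irreducible halg.isIntegral))
  exact ⟨c, by rw [hC, hc]; ring⟩
end

section
/- For every rational function f in k(t,x) (k algebraically closed of characteristic zero), there exists a nonzero linear differential operator L ∈ k(t)⟨D_t⟩ and a rational function g ∈ k(t,x) such that L(f) = D_x(g). -/
open Polynomial in
/-- In characteristic zero every polynomial has an antiderivative. -/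
theorem exists_derivative_eq {K : Type*} [Field K] [CharZero K] (a : K[X]) :
    ∃ b : K[X], derivative b = a := by
  induction a using Polynomial.induction_on' with
  | add p q hp hq =>
    obtain ⟨b, rfl⟩ := hp
    obtain ⟨c, rfl⟩ := hq
    exact ⟨b + c, derivative_add⟩
  | monomial n c =>
    refine ⟨monomial (n + 1) (c / (n + 1)), ?_⟩
    have h : (n : K) + 1 ≠ 0 := by exact_mod_cast n.succ_ne_zero
    rw [derivative_monomial, Nat.add_sub_cancel]
    push_cast
    rw [div_mul_cancel₀ _ h]

open Polynomial in
/-- A derivation of `K(x)` that vanishes on `K` and sends `x` to `1` differentiates polynomials. -/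
theorem derivation_algebraMap_eq_derivative {K L : Type*} [Field K] [Field L] [Algebra ℤ L]
    (δ : Derivation ℤ L L) (φ : K[X] →+* L) (hC : ∀ r, δ (φ (C r)) = 0)
    (hX : δ (φ X) = 1) (p : K[X]) : δ (φ p) = φ (derivative p) := by
  induction p using Polynomial.induction_on' with
  | add p q hp hq => simp [hp, hq]
  | monomial n c =>
    rw [← C_mul_X_pow_eq_monomial, map_mul, Derivation.leibniz, hC, map_pow,
      Derivation.leibniz_pow, hX, derivative_C_mul_X_pow]
    simp [mul_assoc]

open Polynomial in
/-- A derivation that maps constants to polynomials and kills `x` preserves polynomials. -/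
theorem exists_derivation_algebraMap_eq {K L : Type*} [Field K] [Field L] [Algebra ℤ L]
    (δ : Derivation ℤ L L) (φ : K[X] →+* L) (hC : ∀ r, ∃ s, δ (φ (C r)) = φ s)
    (hX : δ (φ X) = 0) (p : K[X]) : ∃ q, δ (φ p) = φ q := by
  induction p using Polynomial.induction_on' with
  | add p q hp hq =>
    obtain ⟨b, hb⟩ := hp
    obtain ⟨c, hc⟩ := hq
    exact ⟨b + c, by simp [hb, hc]⟩
  | monomial n c =>
    obtain ⟨s, hs⟩ := hC c
    refine ⟨X ^ n * s, ?_⟩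
    rw [← C_mul_X_pow_eq_monomial, map_mul, Derivation.leibniz, hs, map_pow,
      Derivation.leibniz_pow, hX]
    simp

/-- A derivation of `k(t)(x)` extending `d/dt` preserves `k(t)`. -/
theorem exists_derivation_ratFuncC_eq {k : Type*} [Field k]
    (δ : Derivation ℤ (RatFunc (RatFunc k)) (RatFunc (RatFunc k)))
    (hk : ∀ a : k, δ (RatFunc.C (RatFunc.C a)) = 0)
    (ht : δ (RatFunc.C RatFunc.X) = 1) (r : RatFunc k) :
    ∃ s : RatFunc k, δ (RatFunc.C r) = RatFunc.C s := by
  set φ : Polynomial k →+* RatFunc (RatFunc k) :=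
    (RatFunc.C (K := RatFunc k)).comp (algebraMap (Polynomial k) (RatFunc k)) with hφ
  have hd := derivation_algebraMap_eq_derivative δ φ
    (fun a => by simpa [hφ] using hk a) (by simpa [hφ] using ht)
  set A := algebraMap (Polynomial k) (RatFunc k)
  have hb : A r.denom ≠ 0 := RatFunc.algebraMap_ne_zero r.denom_ne_zero
  have hb' : RatFunc.C (A r.denom) ≠ 0 := by simpa using hb
  have hr : A r.denom * r = A r.num := by
    rw [mul_comm, ← eq_div_iff hb, RatFunc.num_div_denom]
  have h := congrArg (fun z => δ (RatFunc.C z)) hr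
  have h1 : δ (RatFunc.C (A r.num)) = _ := hd r.num
  have h2 : δ (RatFunc.C (A r.denom)) = _ := hd r.denom
  simp only [map_mul, Derivation.leibniz, smul_eq_mul, h1, h2, hφ, RingHom.comp_apply] at h
  refine ⟨(A r.num.derivative - r * A r.denom.derivative) / A r.denom, ?_⟩
  rw [map_div₀, map_sub, map_mul, eq_div_iff hb', ← h]
  ring

open Polynomial in
/-- Hermite reduction: modulo derivatives, a rational function whose denominator is a power of the
separable polynomial `p` is a proper fraction with denominator `p`. -/
theorem exists_hermite_reduction {K : Type*} [Field K] [CharZero K] [Algebra ℤ (RatFunc K)]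
    (δ : Derivation ℤ (RatFunc K) (RatFunc K))
    (hδ : ∀ q : K[X], δ (algebraMap K[X] (RatFunc K) q) = algebraMap K[X] (RatFunc K) (derivative q))
    {p : K[X]} (hp : p.Separable) (m : ℕ) (a : K[X]) :
    ∃ r ∈ degreeLT K p.natDegree, ∃ g : RatFunc K,
      algebraMap K[X] (RatFunc K) a / algebraMap K[X] (RatFunc K) p ^ (m + 1) =
        algebraMap K[X] (RatFunc K) r / algebraMap K[X] (RatFunc K) p + δ g := by
  have hp0 : p ≠ 0 := hp.ne_zero
  have hP : algebraMap K[X] (RatFunc K) p ≠ 0 := RatFunc.algebraMap_ne_zero hp0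
  induction m generalizing a with
  | zero =>
    obtain ⟨b, hb⟩ := exists_derivative_eq (a / p)
    refine ⟨a % p, ?_, algebraMap K[X] (RatFunc K) b, ?_⟩
    · rw [mem_degreeLT, ← degree_eq_natDegree hp0]
      exact EuclideanDomain.mod_lt a hp0
    · rw [hδ, hb]
      conv_lhs => rw [← EuclideanDomain.mod_add_div a p]
      rw [map_add, map_mul]
      field_simp
      ring
  | succ m ih =>
    obtain ⟨v, w, hvw⟩ := hp
    have hm : (m : K) + 1 ≠ 0 := by exact_mod_cast m.succ_ne_zero
    set e : K[X] := C (((m : K) + 1)⁻¹) * (a * w) with he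
    obtain ⟨r, hr, g, hg⟩ := ih (a * v + derivative e)
    have hae : a = a * v * p + ((m : K[X]) + 1) * e * derivative p := by
      have hc : ((m : K[X]) + 1) * C (((m : K) + 1)⁻¹) = 1 := by
        rw [← C_eq_natCast, ← C_1, ← C_add, ← C_mul, mul_inv_cancel₀ hm]
      linear_combination (-a) * hvw - a * w * derivative p * hc
    clear_value e
    refine ⟨r, hr, g - algebraMap K[X] (RatFunc K) e / algebraMap K[X] (RatFunc K) p ^ (m + 1), ?_⟩
    have hdiv : δ (algebraMap K[X] (RatFunc K) e / algebraMap K[X] (RatFunc K) p ^ (m + 1)) =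
        algebraMap K[X] (RatFunc K) (derivative e) / algebraMap K[X] (RatFunc K) p ^ (m + 1) -
        ((m : RatFunc K) + 1) * algebraMap K[X] (RatFunc K) e *
          algebraMap K[X] (RatFunc K) (derivative p) /
            algebraMap K[X] (RatFunc K) p ^ (m + 2) := by
      rw [Derivation.leibniz_div, Derivation.leibniz_pow, hδ, hδ]
      simp only [smul_eq_mul, nsmul_eq_mul, Nat.add_sub_cancel]
      push_cast
      field_simp
      ring
    rw [map_sub, hdiv]
    have hae' := congrArg (algebraMap K[X] (RatFunc K)) hae
    simp only [map_add, map_mul, map_natCast, map_one] at hae'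
    have : algebraMap K[X] (RatFunc K) a / algebraMap K[X] (RatFunc K) p ^ (m + 1 + 1) =
        algebraMap K[X] (RatFunc K) (a * v + derivative e) /
          algebraMap K[X] (RatFunc K) p ^ (m + 1) -
        (algebraMap K[X] (RatFunc K) (derivative e) / algebraMap K[X] (RatFunc K) p ^ (m + 1) -
        ((m : RatFunc K) + 1) * algebraMap K[X] (RatFunc K) e *
          algebraMap K[X] (RatFunc K) (derivative p) /
            algebraMap K[X] (RatFunc K) p ^ (m + 2)) := by
      rw [hae', map_add, map_mul _ a v]
      field_simp
      ring
    rw [this, hg]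
    ring

open Polynomial in
/-- The iterates of a derivation that preserves `K[x]` keep denominators powers of `p`. -/
theorem exists_iterate_derivation_eq_div {K : Type*} [Field K] [Algebra ℤ (RatFunc K)]
    (δ : Derivation ℤ (RatFunc K) (RatFunc K))
    (hδ : ∀ q : K[X], ∃ s, δ (algebraMap K[X] (RatFunc K) q) = algebraMap K[X] (RatFunc K) s)
    {p : K[X]} (hp : p ≠ 0) {f : RatFunc K}
    (hf : ∃ (a : K[X]) (m : ℕ),
      f = algebraMap K[X] (RatFunc K) a / algebraMap K[X] (RatFunc K) p ^ (m + 1)) (i : ℕ) :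
    ∃ (a : K[X]) (m : ℕ),
      (⇑δ)^[i] f = algebraMap K[X] (RatFunc K) a / algebraMap K[X] (RatFunc K) p ^ (m + 1) := by
  have hP : algebraMap K[X] (RatFunc K) p ≠ 0 := RatFunc.algebraMap_ne_zero hp
  induction i with
  | zero => simpa using hf
  | succ i ih =>
    obtain ⟨a, m, h⟩ := ih
    obtain ⟨b, hb⟩ := hδ a
    obtain ⟨q, hq⟩ := hδ p
    refine ⟨b * p - (m + 1) * a * q, m + 1, ?_⟩
    rw [Function.iterate_succ_apply', h, Derivation.leibniz_div, Derivation.leibniz_pow, hb, hq]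
    simp only [smul_eq_mul, nsmul_eq_mul, Nat.add_sub_cancel, map_sub, map_mul, map_add,
      map_natCast, map_one]
    push_cast
    field_simp
    ring

open Polynomial in
/-- Every rational function is a fraction whose denominator is a power of a squarefree
polynomial. -/
theorem exists_squarefree_eq_div_pow {K : Type*} [Field K] (f : RatFunc K) :
    ∃ p : K[X], Squarefree p ∧ ∃ (a : K[X]) (m : ℕ),
      f = algebraMap K[X] (RatFunc K) a / algebraMap K[X] (RatFunc K) p ^ (m + 1) := by
  obtain ⟨p, n, hsq, -, c, hc⟩ := exists_squarefree_dvd_pow_of_ne_zero f.denom_ne_zero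
  refine ⟨p, hsq, f.num * c * p, n, ?_⟩
  have hP : algebraMap K[X] (RatFunc K) p ≠ 0 := RatFunc.algebraMap_ne_zero hsq.ne_zero
  have hD : algebraMap K[X] (RatFunc K) f.denom ≠ 0 :=
    RatFunc.algebraMap_ne_zero f.denom_ne_zero
  have hc' := congrArg (algebraMap K[X] (RatFunc K)) hc
  rw [map_pow, map_mul] at hc'
  conv_lhs => rw [← RatFunc.num_div_denom f]
  rw [div_eq_div_iff hD (pow_ne_zero _ hP), pow_succ, hc', map_mul, map_mul]
  ring


/-- Theorem 4.1: for every rational function `f ∈ k(t,x)` (`k` algebraically closed of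
characteristic zero) there exist a nonzero linear differential operator
`L = ∑ a_i D_t^i ∈ k(t)⟨D_t⟩` and `g ∈ k(t,x)` with `L(f) = D_x(g)`.
Here `k(t,x)` is modelled as `RatFunc (RatFunc k)` (inner variable `t`, outer
variable `x`); `δt` and `δx` are the partial derivations `D_t` and `D_x`, characterized
by their values on `k`, `t` and `x`. -/
theorem stmt17 {k : Type*} [Field k] [CharZero k] [IsAlgClosed k]
    (δt δx : Derivation ℤ (RatFunc (RatFunc k)) (RatFunc (RatFunc k)))
    (hδtk : ∀ a : k, δt (RatFunc.C (RatFunc.C a)) = 0)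
    (hδtt : δt (RatFunc.C RatFunc.X) = 1)
    (hδtX : δt RatFunc.X = 0)
    (hδxC : ∀ r : RatFunc k, δx (RatFunc.C r) = 0)
    (hδxX : δx RatFunc.X = 1)
    (f : RatFunc (RatFunc k)) :
    ∃ (n : ℕ) (a : Fin (n + 1) → RatFunc k), a ≠ 0 ∧
      ∃ g : RatFunc (RatFunc k),
        ∑ i : Fin (n + 1), RatFunc.C (a i) * (⇑δt)^[i.val] f = δx g := by
  have hx := derivation_algebraMap_eq_derivative δx
    (algebraMap (Polynomial (RatFunc k)) (RatFunc (RatFunc k)))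
    (fun r => by simpa using hδxC r) (by simpa using hδxX)
  have ht := exists_derivation_algebraMap_eq δt
    (algebraMap (Polynomial (RatFunc k)) (RatFunc (RatFunc k)))
    (fun r => by
      obtain ⟨s, hs⟩ := exists_derivation_ratFuncC_eq δt hδtk hδtt r
      exact ⟨Polynomial.C s, by simpa using hs⟩)
    (by simpa using hδtX)
  have : CharZero (RatFunc k) := charZero_of_injective_algebraMap (algebraMap k (RatFunc k)).injective
  obtain ⟨p, hsq, hf⟩ := exists_squarefree_eq_div_pow f
  have hsep : p.Separable := PerfectField.separable_iff_squarefree.mpr hsq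
  have hred : ∀ i : Fin (p.natDegree + 1), ∃ r : Polynomial.degreeLT (RatFunc k) p.natDegree,
      ∃ g : RatFunc (RatFunc k), (⇑δt)^[i.val] f =
        algebraMap _ _ (r : Polynomial (RatFunc k)) / algebraMap _ _ p + δx g := by
    intro i
    obtain ⟨a, m, h⟩ := exists_iterate_derivation_eq_div δt ht hsq.ne_zero hf i
    obtain ⟨r, hr, g, hg⟩ := exists_hermite_reduction δx hx hsep m a
    exact ⟨⟨r, hr⟩, g, h.trans hg⟩
  choose r g hrg using hred
  have hdep : ¬ LinearIndependent (RatFunc k) r := by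
    intro h
    have h1 := (h.map' (Polynomial.degreeLTEquiv (RatFunc k) p.natDegree).toLinearMap
      (LinearEquiv.ker _)).fintype_card_le_finrank
    simp at h1
  obtain ⟨c, hc, i, hi⟩ := Fintype.not_linearIndependent_iff.mp hdep
  refine ⟨p.natDegree, c, fun h => hi (congrFun h i), ∑ i, RatFunc.C (c i) * g i, ?_⟩
  have hc' : ∑ i, RatFunc.C (c i) *
      algebraMap (Polynomial (RatFunc k)) (RatFunc (RatFunc k)) (r i) = 0 := by
    have h := congrArg (fun z : Polynomial.degreeLT (RatFunc k) p.natDegree =>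
      algebraMap (Polynomial (RatFunc k)) (RatFunc (RatFunc k)) z) hc
    simpa [Polynomial.smul_eq_C_mul] using h
  simp only [hrg, mul_add, Finset.sum_add_distrib, map_sum, Derivation.leibniz, hδxC, smul_eq_mul,
    mul_zero, add_zero, ← mul_div_assoc, ← Finset.sum_div, hc', zero_div, zero_add]
end

section
/- Let f = Σ_{i=1}^m Σ_{j=1}^{n_i} α_{i,j}/(x-β_i)^j ∈ k(t,x) be in residual form with respect to Δ_x (β_i in distinct Z-orbits, α_{i,n_i} ≠ 0). Then there exists a nonzero L ∈ k(t)⟨S_t⟩ with L(t,S_t)(f) = Δ_x(g) for some g ∈ k(t,x) if and only if every β_i has the form r_i t + c_i with r_i ∈ Q and c_i ∈ k. -/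
namespace RatFunc

section LaurentExpansion

variable {F : Type*} [Field F]

theorem ringHom_ext_C_X_s19 {L : Type*} [Field L] {f g : RatFunc F →+* L}
    (hC : ∀ a, f (C a) = g (C a)) (hX : f X = g X) : f = g := by
  refine IsFractionRing.injective_comp_algebraMap (A := Polynomial F) ?_
  refine Polynomial.ringHom_ext (fun a => ?_) ?_
  · simpa using hC a
  · simpa using hX

/-- The ring homomorphism sending a polynomial in `x` to its expansion in powers of `x - c`. -/
noncomputable def polyExpand (c : F) : Polynomial F →+* LaurentSeries F :=
  ((HahnSeries.ofPowerSeries ℤ F).comp Polynomial.coeToPowerSeries.ringHom).comp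
    (Polynomial.taylorAlgHom c).toRingHom

theorem polyExpand_apply (c : F) (p : Polynomial F) :
    polyExpand c p = HahnSeries.ofPowerSeries ℤ F (Polynomial.taylor c p : Polynomial F) := rfl

theorem polyExpand_injective (c : F) : Function.Injective (polyExpand c) := by
  intro p q h
  rw [polyExpand_apply, polyExpand_apply] at h
  exact Polynomial.taylor_injective c
    (Polynomial.coe_injective F (HahnSeries.ofPowerSeries_injective h))

/-- The Laurent expansion of a rational function in powers of `x - c`. -/
noncomputable def expand (c : F) : RatFunc F →+* LaurentSeries F :=
  liftRingHom (polyExpand c)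
    (nonZeroDivisors_le_comap_nonZeroDivisors_of_injective _ (polyExpand_injective c))

theorem expand_C (c a : F) : expand c (C a) = HahnSeries.C a := by
  rw [← algebraMap_C, expand, liftRingHom_algebraMap, polyExpand_apply, Polynomial.taylor_C,
    Polynomial.coe_C, HahnSeries.ofPowerSeries_C]

theorem expand_X (c : F) : expand c X = HahnSeries.single 1 1 + HahnSeries.C c := by
  rw [← algebraMap_X, expand, liftRingHom_algebraMap, polyExpand_apply, Polynomial.taylor_X,
    Polynomial.coe_add, Polynomial.coe_C, Polynomial.coe_X, map_add, HahnSeries.ofPowerSeries_C,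
    HahnSeries.ofPowerSeries_X]

/-- The coefficient of `(x - c) ^ (-(j + 1))` in the Laurent expansion at `c`. -/
noncomputable def polarCoeff (c : F) (j : ℕ) (h : RatFunc F) : F :=
  (expand c h).coeff (-(j + 1 : ℤ))

theorem polarCoeff_sub (c : F) (j : ℕ) (g h : RatFunc F) :
    polarCoeff c j (g - h) = polarCoeff c j g - polarCoeff c j h := by
  simp [polarCoeff]

theorem polarCoeff_sum {ι : Type*} (c : F) (j : ℕ) (s : Finset ι) (g : ι → RatFunc F) :
    polarCoeff c j (∑ i ∈ s, g i) = ∑ i ∈ s, polarCoeff c j (g i) := by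
  simp [polarCoeff]

theorem polarCoeff_C_mul (c : F) (j : ℕ) (a : F) (h : RatFunc F) :
    polarCoeff c j (C a * h) = a * polarCoeff c j h := by
  simp [polarCoeff, expand_C]

theorem polarCoeff_div_eq_zero {c : F} (j : ℕ) (p : Polynomial F) {q : Polynomial F}
    (hq : q.eval c ≠ 0) :
    polarCoeff c j (algebraMap _ (RatFunc F) p / algebraMap _ (RatFunc F) q) = 0 := by
  have hq0 : polyExpand c q ≠ 0 := by
    rw [Ne, map_eq_zero_iff _ (polyExpand_injective c)]
    rintro rfl
    simp at hq
  have hc : PowerSeries.constantCoeff (Polynomial.taylor c q : PowerSeries F) ≠ 0 := by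
    rwa [← PowerSeries.coeff_zero_eq_constantCoeff_apply, Polynomial.coeff_coe,
      Polynomial.taylor_coeff_zero]
  have key : expand c (algebraMap _ (RatFunc F) p / algebraMap _ (RatFunc F) q) =
      HahnSeries.ofPowerSeries ℤ F
        ((Polynomial.taylor c p : PowerSeries F) * (Polynomial.taylor c q : PowerSeries F)⁻¹) := by
    rw [expand, liftRingHom_apply_div, div_eq_iff hq0, polyExpand_apply, polyExpand_apply,
      ← map_mul, mul_assoc, PowerSeries.inv_mul_cancel _ hc, mul_one]
  rw [polarCoeff, key, HahnSeries.ofPowerSeries_apply, HahnSeries.embDomain_of_notMem_range]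
  rintro ⟨i, hi⟩
  have : (i : ℤ) = -(j + 1) := by simpa using hi
  omega

theorem finite_polarCoeff_ne_zero (j : ℕ) (h : RatFunc F) :
    {c : F | polarCoeff c j h ≠ 0}.Finite := by
  classical
  refine (h.denom.roots.toFinset.finite_toSet).subset fun c hc => ?_
  by_contra hcon
  refine hc ?_
  rw [← num_div_denom h]
  refine polarCoeff_div_eq_zero j _ fun h0 => hcon ?_
  simpa [denom_ne_zero] using h0

open Classical in
theorem polarCoeff_C_div_pow (c a b : F) (j j' : ℕ) :
    polarCoeff c j (C a / (X - C b) ^ (j' + 1)) = if b = c ∧ j' = j then a else 0 := by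
  by_cases hbc : b = c
  · subst hbc
    have : expand b (C a / (X - C b) ^ (j' + 1)) =
        HahnSeries.single (-(j' + 1 : ℤ)) a := by
      rw [map_div₀, map_pow, map_sub, expand_C, expand_C, expand_X, add_sub_cancel_right,
        HahnSeries.single_pow, div_eq_iff (by simp [HahnSeries.single_eq_zero_iff]),
        HahnSeries.single_mul_single]
      simp [HahnSeries.C_apply]
    rw [polarCoeff, this, HahnSeries.coeff_single]
    simp [eq_comm]
  · rw [if_neg fun h => hbc h.1]
    have := polarCoeff_div_eq_zero (c := c) j (Polynomial.C a)
      (q := (Polynomial.X - Polynomial.C b) ^ (j' + 1))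
      (by simpa [sub_eq_zero] using fun h => hbc h.symm)
    simpa using this

open Classical in
theorem polarCoeff_sum_div_pow {ι : Type*} [Fintype ι] (n : ι → ℕ) (a : ι → ℕ → F) (b : ι → F)
    (c : F) (j : ℕ) :
    polarCoeff c j (∑ i, ∑ l ∈ Finset.range (n i), C (a i l) / (X - C (b i)) ^ (l + 1)) =
      ∑ i, if b i = c ∧ j < n i then a i j else 0 := by
  rw [polarCoeff_sum]
  refine Finset.sum_congr rfl fun i _ => ?_
  simp_rw [polarCoeff_sum, polarCoeff_C_div_pow]
  by_cases hi : b i = c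
  · simp [hi]
  · simp [hi]

theorem polarCoeff_shift (τ : RatFunc F →+* RatFunc F) (hC : ∀ a, τ (C a) = C a)
    (hX : τ X = X + 1) (c : F) (j : ℕ) (h : RatFunc F) :
    polarCoeff c j (τ h) = polarCoeff (c + 1) j h := by
  have : (expand c).comp τ = expand (c + 1) := by
    refine ringHom_ext_C_X_s19 (fun a => ?_) ?_
    · simp [hC, expand_C]
    · simp [hX, expand_X, add_assoc]
  rw [polarCoeff, polarCoeff, ← this, RingHom.comp_apply]

/-- A difference `τ g - g` cannot have a polar coefficient supported at one point of a
`ℤ`-orbit. -/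
theorem polarCoeff_eq_zero_of_isolated [CharZero F] (τ : RatFunc F →+* RatFunc F)
    (hC : ∀ a, τ (C a) = C a) (hX : τ X = X + 1) (g : RatFunc F) (c : F) (j : ℕ)
    (h : ∀ z : ℤ, z ≠ 0 → polarCoeff (c + z) j (τ g - g) = 0) :
    polarCoeff c j (τ g - g) = 0 := by
  set u : ℤ → F := fun z => polarCoeff (c + z) j g with hu
  have hstep (z : ℤ) : polarCoeff (c + z) j (τ g - g) = u (z + 1) - u z := by
    simp [polarCoeff_sub, polarCoeff_shift τ hC hX, hu, add_assoc]
  have hfin : {z : ℤ | u z ≠ 0}.Finite := by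
    refine Set.Finite.preimage (f := fun z : ℤ => c + (z : F)) ?_ (finite_polarCoeff_ne_zero j g)
    intro x _ y _ hxy
    simpa using hxy
  have hpos (l : ℕ) : u (1 + l) = u 1 := by
    induction l with
    | zero => simp
    | succ l ih =>
      have := hstep (1 + l)
      rw [h _ (by omega), ih] at this
      push_cast
      rw [← add_assoc]
      exact sub_eq_zero.mp this.symm
  have hneg (l : ℕ) : u (-l) = u 0 := by
    induction l with
    | zero => simp
    | succ l ih =>
      have := hstep (-(l + 1))
      rw [h _ (by omega), show -((l : ℤ) + 1) + 1 = -l by ring, ih] at this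
      push_cast
      exact (sub_eq_zero.mp this.symm).symm
  have h1 : u 1 = 0 := by
    by_contra h1
    refine Set.infinite_of_injective_forall_mem (f := fun l : ℕ => (1 + l : ℤ)) ?_ ?_ hfin
    · intro x y hxy
      simpa using hxy
    · intro l
      simpa [hpos l] using h1
  have h0 : u 0 = 0 := by
    by_contra h0
    refine Set.infinite_of_injective_forall_mem (f := fun l : ℕ => (-l : ℤ)) ?_ ?_ hfin
    · intro x y hxy
      simpa using hxy
    · intro l
      simpa [hneg l] using h0
  have := hstep 0
  simpa [h0, h1] using this

end LaurentExpansion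

end RatFunc

section FixedElements

open Polynomial in
/-- An element algebraic over `k(t)` and fixed by an automorphism `t ↦ t + l`, `l ≠ 0`, is a
constant. -/
theorem exists_const_of_fixed {k : Type*} [Field k] [CharZero k] [IsAlgClosed k]
    (s : RingAut (AlgebraicClosure (RatFunc k)))
    (hsk : ∀ a : k, s (algebraMap (RatFunc k) (AlgebraicClosure (RatFunc k)) (RatFunc.C a))
      = algebraMap (RatFunc k) (AlgebraicClosure (RatFunc k)) (RatFunc.C a))
    (l : ℕ) (hl : l ≠ 0)
    (hst : s (algebraMap (RatFunc k) (AlgebraicClosure (RatFunc k)) RatFunc.X)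
      = algebraMap (RatFunc k) (AlgebraicClosure (RatFunc k)) RatFunc.X + l)
    (x : AlgebraicClosure (RatFunc k)) (hx : s x = x) :
    ∃ c : k, x = algebraMap (RatFunc k) (AlgebraicClosure (RatFunc k)) (RatFunc.C c) := by
  set t := algebraMap (RatFunc k) (AlgebraicClosure (RatFunc k)) RatFunc.X with ht
  have hkF (a : k) : algebraMap (RatFunc k) (AlgebraicClosure (RatFunc k)) (RatFunc.C a) =
      algebraMap k (AlgebraicClosure (RatFunc k)) a := by
    rw [IsScalarTower.algebraMap_apply k (RatFunc k) (AlgebraicClosure (RatFunc k))]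
    rfl
  simp_rw [hkF] at hsk ⊢
  have : CharZero (AlgebraicClosure (RatFunc k)) :=
    charZero_of_injective_algebraMap (algebraMap k _).injective
  suffices hxk : IsAlgebraic k x by
    obtain ⟨c, hc⟩ := minpoly.mem_range_of_degree_eq_one k x
      (IsAlgClosed.degree_eq_one_of_irreducible k (minpoly.irreducible hxk.isIntegral))
    exact ⟨c, hc.symm⟩
  obtain ⟨P, hP0, hP⟩ : IsAlgebraic k[X] x :=
    (IsFractionRing.isAlgebraic_iff k[X] (RatFunc k) (AlgebraicClosure (RatFunc k))).mpr
      (Algebra.IsAlgebraic.isAlgebraic x)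
  set Q := (Bivariate.swap P).map (aeval x : k[X] →ₐ[k] _).toRingHom with hQ
  have hQt : Q.eval t = 0 := by
    have key : (((evalRingHom t).comp (mapRingHom (aeval x : k[X] →ₐ[k] _).toRingHom)).comp
        (Bivariate.swap (R := k)).toRingEquiv.toRingHom) =
        eval₂RingHom (algebraMap k[X] (AlgebraicClosure (RatFunc k))) x := by
      refine Polynomial.ringHom_ext' (Polynomial.ringHom_ext (fun a => ?_) ?_) ?_
      · simp [Bivariate.swap_apply]
        exact IsScalarTower.algebraMap_apply k k[X] _ a
      · simp [Bivariate.swap_apply]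
        rw [ht, IsScalarTower.algebraMap_apply k[X] (RatFunc k) (AlgebraicClosure (RatFunc k)),
          RatFunc.algebraMap_X]
      · simp [Bivariate.swap_apply]
    exact (RingHom.congr_fun key P).trans hP
  have hQs : Q.map (s : AlgebraicClosure (RatFunc k) →+* AlgebraicClosure (RatFunc k)) = Q := by
    rw [hQ, Polynomial.map_map]
    congr 1
    refine Polynomial.ringHom_ext (fun a => ?_) ?_
    · simpa using hsk a
    · simpa using hx
  have hroot (j : ℕ) : Q.eval (t + (j * l : ℕ)) = 0 := by
    induction j with
    | zero => simpa using hQt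
    | succ j ih =>
      have := congrArg s ih
      rw [map_zero, ← RingEquiv.coe_toRingHom, ← Polynomial.eval_map_apply, hQs] at this
      rw [← this]
      congr 1
      simp [hst]
      ring
  have hQ0 : Q = 0 := by
    refine Polynomial.eq_zero_of_infinite_isRoot Q
      ((Set.infinite_range_of_injective (f := fun j : ℕ => t + (j * l : ℕ)) ?_).mono ?_)
    · intro a b hab
      simpa [hl] using hab
    · rintro _ ⟨j, rfl⟩
      exact hroot j
  have hS0 : Bivariate.swap P ≠ 0 := by simpa using hP0
  obtain ⟨i, hi⟩ : ∃ i, (Bivariate.swap P).coeff i ≠ 0 := by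
    by_contra! h
    exact hS0 (Polynomial.ext h)
  refine ⟨_, hi, ?_⟩
  have := congrArg (fun q => q.coeff i) hQ0
  simpa [hQ] using this

end FixedElements

namespace RatFunc

section ShiftedPolarParts

variable {F : Type*} [Field F] {m : ℕ} (n : Fin m → ℕ) (α : Fin m → ℕ → F) (β : Fin m → F)

theorem iterate_coeff_map (σ : RingAut F) (St : RatFunc F →+* RatFunc F)
    (hC : ∀ a, St (C a) = C (σ a)) (hX : St X = X) (l : ℕ) :
    St^[l] (∑ i, ∑ j ∈ Finset.range (n i), C (α i j) / (X - C (β i)) ^ (j + 1)) =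
      ∑ i, ∑ j ∈ Finset.range (n i),
        C ((σ ^ l) (α i j)) / (X - C ((σ ^ l) (β i))) ^ (j + 1) := by
  have hCl (a : F) : (St ^ l) (C a) = C ((σ ^ l) a) := by
    induction l with
    | zero => simp
    | succ l ih => rw [pow_succ', pow_succ', RingHom.mul_def, RingHom.comp_apply, ih, hC]; rfl
  have hXl : (St ^ l) X = X := by
    clear hCl
    induction l with
    | zero => simp
    | succ l ih => rw [pow_succ', RingHom.mul_def, RingHom.comp_apply, ih, hX]
  rw [← RingHom.coe_pow]
  simp only [map_sum, map_div₀, map_pow, map_sub, hCl, hXl]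

/-- If a nonzero operator maps a rational function in residual form to a difference, then each
`ℤ`-orbit of poles is periodic under `σ`. -/
theorem exists_period_of_telescoper [CharZero F] (hn : ∀ i, 0 < n i)
    (hα : ∀ i, α i (n i - 1) ≠ 0)
    (hβ : ∀ i i', i ≠ i' → ∀ z : ℤ, β i ≠ β i' + (z : F)) (σ : RingAut F)
    (τ : RatFunc F →+* RatFunc F) (hC : ∀ a, τ (C a) = C a) (hX : τ X = X + 1)
    (N : ℕ) (a : Fin (N + 1) → F) (ha : a ≠ 0) (g : RatFunc F)
    (h : ∑ l : Fin (N + 1), C (a l) * ∑ i, ∑ j ∈ Finset.range (n i),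
        C ((σ ^ l.val) (α i j)) / (X - C ((σ ^ l.val) (β i))) ^ (j + 1) = τ g - g) (i : Fin m) :
    ∃ l : ℕ, l ≠ 0 ∧ ∃ z : ℤ, (σ ^ l) (β i) = β i + z := by
  classical
  by_contra! hcon
  have hzpow (l : ℕ) (s : ℤ) (x y : F) (z : ℤ) :
      (σ ^ l) x = (σ ^ (s + l)) y + z ↔ x = (σ ^ s) y + z := by
    rw [← (σ ^ l).injective.eq_iff (a := x), map_add, map_intCast, add_comm s, zpow_add,
      RingAut.mul_apply, zpow_natCast]
  set S : Set ℤ := {s | ∃ i' : Fin m, ∃ z : ℤ, β i' = (σ ^ s) (β i) + z} with hS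
  have hSfin : S.Finite := by
    choose f hf using fun s : S => s.2
    have hinj : Function.Injective f := by
      have hlt (s s' : S) (hss : f s = f s') : ¬ (s : ℤ) < s' := by
        intro hlt
        obtain ⟨z, hz⟩ := hf s
        obtain ⟨z', hz'⟩ := hf s'
        obtain ⟨d, hd⟩ := Int.le.dest hlt.le
        refine hcon d (by omega) (z - z') ((σ ^ (s : ℤ)).injective ?_)
        rw [← zpow_natCast, ← RingAut.mul_apply, ← zpow_add, hd, map_add, map_intCast]
        push_cast
        linear_combination hz - hz' - congrArg β hss
      intro s s' hss
      exact Subtype.ext (le_antisymm (not_lt.mp (hlt s' s hss.symm)) (not_lt.mp (hlt s s' hss)))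
    exact (Finite.of_injective f hinj : Finite S)
  obtain ⟨s, ⟨i₁, z₁, hi₁⟩, hmax⟩ :=
    hSfin.exists_maximal (⟨0, i, 0, by simp⟩ : S.Nonempty)
  obtain ⟨l₀, hl₀, hlmax⟩ := (Finset.univ.filter fun l => a l ≠ 0).exists_max_image id (by
    obtain ⟨l, hl⟩ := Function.ne_iff.mp ha
    exact ⟨l, by simpa using hl⟩)
  simp only [Finset.mem_filter, Finset.mem_univ, true_and, id] at hl₀ hlmax
  have huniq (l : Fin (N + 1)) (i' : Fin m) (z : ℤ) (hal : a l ≠ 0)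
      (heq : (σ ^ l.val) (β i') = (σ ^ l₀.val) (β i₁) + z) : l = l₀ ∧ i' = i₁ ∧ z = 0 := by
    have hle : (l : ℕ) ≤ l₀ := hlmax l hal
    have h1 : β i' = (σ ^ ((l₀ : ℤ) - l)) (β i₁) + z := by
      rw [← hzpow l, sub_add_cancel, zpow_natCast, heq]
    have h2 : ((l₀ : ℤ) - l + s) ∈ S := by
      refine ⟨i', z₁ + z, ?_⟩
      rw [h1, hi₁, map_add, map_intCast, zpow_add, RingAut.mul_apply]
      push_cast
      ring
    have h3 := hmax h2 (by simpa using hle)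
    have hl : l = l₀ := Fin.ext (by omega)
    subst hl
    rw [sub_self, zpow_zero, RingAut.one_apply] at h1
    have hi : i' = i₁ := by
      by_contra hne
      exact hβ i' i₁ hne z h1
    subst hi
    exact ⟨rfl, rfl, by simpa using h1⟩
  set J := n i₁ - 1 with hJ
  have hcoeff (z : ℤ) : polarCoeff ((σ ^ l₀.val) (β i₁) + z) J (τ g - g) =
      if z = 0 then a l₀ * (σ ^ l₀.val) (α i₁ J) else 0 := by
    rw [← h, polarCoeff_sum]
    simp_rw [polarCoeff_C_mul, polarCoeff_sum_div_pow]
    split_ifs with hz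
    · subst hz
      rw [Finset.sum_eq_single l₀, Finset.sum_eq_single i₁]
      · have := hn i₁
        rw [if_pos ⟨by simp, by omega⟩]
      · intro i' _ hi'
        rw [if_neg]
        rintro ⟨h1, -⟩
        exact hi' (huniq l₀ i' 0 hl₀ h1).2.1
      · simp
      · intro l _ hl
        by_cases hal : a l = 0
        · simp [hal]
        refine mul_eq_zero_of_right _ (Finset.sum_eq_zero fun i' _ => if_neg ?_)
        rintro ⟨h1, -⟩
        exact hl (huniq l i' 0 hal h1).1
      · simp
    · refine Finset.sum_eq_zero fun l _ => ?_
      by_cases hal : a l = 0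
      · simp [hal]
      refine mul_eq_zero_of_right _ (Finset.sum_eq_zero fun i' _ => if_neg ?_)
      rintro ⟨h1, -⟩
      exact hz (huniq l i' z hal h1).2.2
  have hzero := polarCoeff_eq_zero_of_isolated τ hC hX g ((σ ^ l₀.val) (β i₁)) J
    fun z hz => by rw [hcoeff, if_neg hz]
  have := hcoeff 0
  rw [Int.cast_zero, add_zero, hzero, if_pos rfl] at this
  exact mul_ne_zero hl₀ ((map_ne_zero_iff _ (σ ^ l₀.val).injective).mpr (hα i₁)) this.symm

end ShiftedPolarParts

section Descent

/-- The additive group of differences `τ g - g`, with `g` in the range of `ι`. -/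
noncomputable def differenceSubgroup {K F : Type*} [Field K] [Field F]
    (ι : RatFunc K →+* RatFunc F) (τ : RatFunc F →+* RatFunc F) :
    AddSubgroup (RatFunc F) :=
  ι.range.toAddSubgroup.map (τ.toAddMonoidHom - AddMonoidHom.id _)

theorem mem_differenceSubgroup {K F : Type*} [Field K] [Field F]
    {ι : RatFunc K →+* RatFunc F} {τ : RatFunc F →+* RatFunc F} {h : RatFunc F} :
    h ∈ differenceSubgroup ι τ ↔ ∃ g ∈ Set.range ι, h = τ g - g := by
  simp [differenceSubgroup, eq_comm]

variable {K F : Type*} [Field K] [Field F] [Algebra K F]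

/-- The partial fraction coefficients of a rational function over `K` with poles in `K` lie in
`K`. -/
theorem mem_range_algebraMap_of_mem_range [IsGalois K F]
    (ι : RatFunc K →+* RatFunc F) (hιC : ∀ r, ι (C r) = C (algebraMap K F r)) (hιX : ι X = X)
    {m : ℕ} (n : Fin m → ℕ) (α : Fin m → ℕ → F) (β : Fin m → F) (hβ : Function.Injective β)
    (hβK : ∀ i, β i ∈ Set.range (algebraMap K F))
    (hf : ∑ i, ∑ j ∈ Finset.range (n i), C (α i j) / (X - C (β i)) ^ (j + 1) ∈ Set.range ι)
    (i : Fin m) (j : ℕ) (hj : j < n i) : α i j ∈ Set.range (algebraMap K F) := by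
  classical
  rw [InfiniteGalois.mem_range_algebraMap_iff_fixed]
  intro ρ
  let T : RatFunc F →+* RatFunc F := liftRingHom
    ((algebraMap (Polynomial F) (RatFunc F)).comp (Polynomial.mapRingHom (ρ : F →+* F)))
    (nonZeroDivisors_le_comap_nonZeroDivisors_of_injective _
      ((algebraMap_injective F).comp (Polynomial.map_injective _ (ρ : F →+* F).injective)))
  have hTC (a : F) : T (C a) = C (ρ a) := by
    rw [← algebraMap_C, liftRingHom_algebraMap]
    simp
  have hTX : T X = X := by
    rw [← algebraMap_X, liftRingHom_algebraMap]
    simp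
  have hTι : T.comp ι = ι := by
    refine ringHom_ext_C_X_s19 (fun a => ?_) ?_
    · simp [hιC, hTC]
    · simp [hιX, hTX]
  have hβρ (i : Fin m) : ρ (β i) = β i := by
    obtain ⟨b, hb⟩ := hβK i
    rw [← hb, ρ.commutes]
  obtain ⟨f, hf⟩ := hf
  have key := RingHom.congr_fun hTι f
  rw [RingHom.comp_apply, hf] at key
  simp only [map_sum, map_div₀, map_pow, map_sub, hTC, hTX, hβρ] at key
  have := congrArg (polarCoeff (β i) j) key
  rw [polarCoeff_sum_div_pow, polarCoeff_sum_div_pow] at this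
  simpa [hβ.eq_iff, Finset.sum_ite, Finset.filter_and, hj, ite_and] using this

theorem sub_shift_one_mem_differenceSubgroup (ι : RatFunc K →+* RatFunc F)
    (hιC : ∀ r, ι (C r) = C (algebraMap K F r)) (hιX : ι X = X)
    (τ : RatFunc F →+* RatFunc F) (hC : ∀ a, τ (C a) = C a) (hX : τ X = X + 1)
    (u b : K) (j : ℕ) :
    C (algebraMap K F u) / (X - C (algebraMap K F b)) ^ (j + 1) -
      C (algebraMap K F u) / (X - C (algebraMap K F b + 1)) ^ (j + 1) ∈
        differenceSubgroup ι τ := by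
  rw [mem_differenceSubgroup]
  refine ⟨C (algebraMap K F u) / (X - C (algebraMap K F b + 1)) ^ (j + 1),
    ⟨C u / (X - C (b + 1)) ^ (j + 1), ?_⟩, ?_⟩
  · simp [hιC, hιX]
  · simp [hC, hX]

theorem sub_shift_mem_differenceSubgroup (ι : RatFunc K →+* RatFunc F)
    (hιC : ∀ r, ι (C r) = C (algebraMap K F r)) (hιX : ι X = X)
    (τ : RatFunc F →+* RatFunc F) (hC : ∀ a, τ (C a) = C a) (hX : τ X = X + 1)
    (u b : K) (j : ℕ) (z : ℤ) :
    C (algebraMap K F u) / (X - C (algebraMap K F b + z)) ^ (j + 1) -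
      C (algebraMap K F u) / (X - C (algebraMap K F b)) ^ (j + 1) ∈
        differenceSubgroup ι τ := by
  have hstep (z : ℤ) := sub_shift_one_mem_differenceSubgroup ι hιC hιX τ hC hX u (b + z) j
  simp only [map_add, map_one, map_intCast] at hstep ⊢
  induction z using Int.induction_on with
  | zero => simp
  | succ l ih =>
    have := sub_mem ih (hstep l)
    convert this using 1
    push_cast
    ring
  | pred l ih =>
    have := add_mem ih (hstep (-l - 1))
    convert this using 1
    push_cast
    ring

/-- If `σ ^ q` translates every pole by an integer, a nonzero operator maps the rational function
to a difference. -/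
theorem exists_telescoper (ι : RatFunc K →+* RatFunc F)
    (hιC : ∀ r, ι (C r) = C (algebraMap K F r)) (hιX : ι X = X)
    (τ : RatFunc F →+* RatFunc F) (hC : ∀ a, τ (C a) = C a) (hX : τ X = X + 1)
    {m : ℕ} (n : Fin m → ℕ) (α : Fin m → ℕ → F) (β : Fin m → F)
    (hαK : ∀ i, ∀ j < n i, α i j ∈ Set.range (algebraMap K F))
    (hβK : ∀ i, β i ∈ Set.range (algebraMap K F)) (σ : RingAut F)
    (hσ : ∀ v, σ (algebraMap K F v) ∈ Set.range (algebraMap K F)) (q : ℕ) (hq : q ≠ 0)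
    (z : Fin m → ℤ) (hz : ∀ i, (σ ^ q) (β i) = β i + z i) :
    ∃ (N : ℕ) (a : Fin (N + 1) → K), a ≠ 0 ∧ ∃ g ∈ Set.range ι,
      ∑ l : Fin (N + 1), C (algebraMap K F (a l)) * ∑ i, ∑ j ∈ Finset.range (n i),
        C ((σ ^ l.val) (α i j)) / (X - C ((σ ^ l.val) (β i))) ^ (j + 1) = τ g - g := by
  classical
  have hσl (l : ℕ) (v : K) : (σ ^ l) (algebraMap K F v) ∈ Set.range (algebraMap K F) := by
    induction l with
    | zero => exact ⟨v, rfl⟩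
    | succ l ih =>
      obtain ⟨w, hw⟩ := ih
      rw [pow_succ', RingAut.mul_apply, ← hw]
      exact hσ w
  have hzl (l : ℕ) (i : Fin m) : (σ ^ (q * l)) (β i) = β i + (l * z i : ℤ) := by
    induction l with
    | zero => simp
    | succ l ih =>
      rw [mul_add, mul_one, add_comm, pow_add, RingAut.mul_apply, ih, map_add, map_intCast, hz]
      push_cast
      ring
  have hexist (l : ℕ) (i : Fin m) (j : ℕ) :
      ∃ w, j < n i → algebraMap K F w = (σ ^ (q * l)) (α i j) := by
    by_cases hj : j < n i
    · obtain ⟨u, hu⟩ := hαK i j hj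
      obtain ⟨w, hw⟩ := hσl (q * l) u
      exact ⟨w, fun _ => by rw [hw, hu]⟩
    · exact ⟨0, fun h => absurd h hj⟩
  choose e he using hexist
  choose b hb using hβK
  let v : ℕ → ((Σ i, Fin (n i)) → K) := fun l p => e l p.1 p.2
  have hdep : ¬ LinearIndependent K v := fun hv => by
    have := hv.finite
    exact not_finite ℕ
  obtain ⟨s, c, hsum, l₁, hl₁, hcl₁⟩ := not_linearIndependent_iff.mp hdep
  have hrel (i : Fin m) (j : ℕ) (hj : j < n i) : ∑ l ∈ s, c l * e l i j = 0 := by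
    simpa [v] using congrFun hsum ⟨i, ⟨j, hj⟩⟩
  let a : ℕ → K := fun d => if q ∣ d ∧ d / q ∈ s then c (d / q) else 0
  have ha (l : ℕ) (hl : l ∈ s) : a (q * l) = c l := by
    simp [a, Nat.mul_div_cancel_left l (Nat.pos_of_ne_zero hq), hl]
  have hbound (l : ℕ) (hl : l ∈ s) : q * l < q * s.sup id + 1 :=
    Nat.lt_succ_of_le (Nat.mul_le_mul_left q (Finset.le_sup (f := id) hl))
  have hreindex (G : ℕ → RatFunc F) :
      ∑ l : Fin (q * s.sup id + 1), C (algebraMap K F (a l)) * G l =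
        ∑ l ∈ s, C (algebraMap K F (c l)) * G (q * l) := by
    rw [Fin.sum_univ_eq_sum_range (fun d => C (algebraMap K F (a d)) * G d)]
    have hinj : Set.InjOn (fun l => q * l) s := fun x _ y _ hxy => by
      simpa [hq] using hxy
    have hsub : s.image (fun l => q * l) ⊆ Finset.range (q * s.sup id + 1) := by
      intro d hd
      obtain ⟨l, hl, rfl⟩ := Finset.mem_image.mp hd
      exact Finset.mem_range.mpr (hbound l hl)
    rw [← Finset.sum_subset hsub, Finset.sum_image hinj]
    · exact Finset.sum_congr rfl fun l hl => by rw [ha l hl]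
    · intro d _ hd
      have : a d = 0 := if_neg fun h => hd
        (Finset.mem_image.mpr ⟨d / q, h.2, Nat.mul_div_cancel' h.1⟩)
      simp [this]
  refine ⟨q * s.sup id, fun l => a l, fun h0 => hcl₁ ?_, ?_⟩
  · have := congrFun h0 ⟨q * l₁, hbound l₁ hl₁⟩
    simpa [ha l₁ hl₁] using this
  rw [← mem_differenceSubgroup, hreindex fun d => ∑ i, ∑ j ∈ Finset.range (n i),
    C ((σ ^ d) (α i j)) / (X - C ((σ ^ d) (β i))) ^ (j + 1)]
  have hvanish : ∑ l ∈ s, C (algebraMap K F (c l)) * ∑ i, ∑ j ∈ Finset.range (n i),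
      C (algebraMap K F (e l i j)) / (X - C (β i)) ^ (j + 1) = 0 := by
    simp_rw [Finset.mul_sum]
    rw [Finset.sum_comm]
    refine Finset.sum_eq_zero fun i _ => ?_
    rw [Finset.sum_comm]
    refine Finset.sum_eq_zero fun j hj => ?_
    simp_rw [← mul_div_assoc, ← map_mul]
    rw [← Finset.sum_div, ← map_sum, ← map_sum, hrel i j (Finset.mem_range.mp hj)]
    simp
  rw [← sub_zero (∑ l ∈ s, _), ← hvanish, ← Finset.sum_sub_distrib]
  refine sum_mem fun l _ => ?_
  rw [← mul_sub, ← Finset.sum_sub_distrib, Finset.mul_sum]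
  refine sum_mem fun i _ => ?_
  rw [← Finset.sum_sub_distrib, Finset.mul_sum]
  refine sum_mem fun j hj => ?_
  rw [← he l i j (Finset.mem_range.mp hj), hzl, ← hb, mul_sub, ← mul_div_assoc, ← mul_div_assoc,
    ← map_mul, ← map_mul]
  exact sub_shift_mem_differenceSubgroup ι hιC hιX τ hC hX _ _ _ _

end Descent

end RatFunc

/-- Theorem 4.5 (Abramov–Le): let `k` be algebraically closed of characteristic zero,
`F` the algebraic closure of `k(t)`, and
`f = ∑_{i=1}^m ∑_{j=1}^{n_i} α_{i,j}/(x-β_i)^j` in residual form with respect to `Δ_x`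
(the `β_i` in distinct `ℤ`-orbits and the top coefficients `α_{i,n_i}` nonzero), with
`f ∈ k(t,x)`.  Then there is a nonzero operator `L = ∑ a_ℓ S_t^ℓ ∈ k(t)⟨S_t⟩` with
`L(f) = Δ_x(g)` for some `g ∈ k(t,x)` if and only if every `β_i` has the form
`r_i t + c_i` with `r_i ∈ ℚ` and `c_i ∈ k`.  Here `σ` is an extension of the shift
`t ↦ t+1` to `F`, `St` the induced coefficientwise action on `F(x)`, `ι : k(t)(x) → F(x)`
the canonical inclusion, and `τx` the shift `x ↦ x+1` of `F(x)` (so `Δ_x g = τx g - g`).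
Multiplicity `j+1` corresponds to the index `j ∈ {0, …, n_i - 1}`. -/
theorem stmt19 {k : Type*} [Field k] [CharZero k] [IsAlgClosed k]
    (m : ℕ) (n : Fin m → ℕ) (hn : ∀ i, 0 < n i)
    (α : Fin m → ℕ → AlgebraicClosure (RatFunc k))
    (β : Fin m → AlgebraicClosure (RatFunc k))
    (hα : ∀ i, α i (n i - 1) ≠ 0)
    (hβ : ∀ i i' : Fin m, i ≠ i' →
      ∀ z : ℤ, β i ≠ β i' + (z : AlgebraicClosure (RatFunc k)))
    (f : RatFunc (AlgebraicClosure (RatFunc k)))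
    (hfdef : f = ∑ i : Fin m, ∑ j ∈ Finset.range (n i),
      RatFunc.C (α i j) / (RatFunc.X - RatFunc.C (β i)) ^ (j + 1))
    (ι : RatFunc (RatFunc k) →+* RatFunc (AlgebraicClosure (RatFunc k)))
    (hιC : ∀ r : RatFunc k, ι (RatFunc.C r)
      = RatFunc.C (algebraMap (RatFunc k) (AlgebraicClosure (RatFunc k)) r))
    (hιX : ι RatFunc.X = RatFunc.X)
    (hf : f ∈ Set.range ι)
    (σ : RingAut (AlgebraicClosure (RatFunc k)))
    (hσk : ∀ a : k, σ (algebraMap (RatFunc k) (AlgebraicClosure (RatFunc k)) (RatFunc.C a))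
      = algebraMap (RatFunc k) (AlgebraicClosure (RatFunc k)) (RatFunc.C a))
    (hσt : σ (algebraMap (RatFunc k) (AlgebraicClosure (RatFunc k)) RatFunc.X)
      = algebraMap (RatFunc k) (AlgebraicClosure (RatFunc k)) RatFunc.X + 1)
    (St : RatFunc (AlgebraicClosure (RatFunc k)) →+* RatFunc (AlgebraicClosure (RatFunc k)))
    (hStC : ∀ a : AlgebraicClosure (RatFunc k), St (RatFunc.C a) = RatFunc.C (σ a))
    (hStX : St RatFunc.X = RatFunc.X)
    (τx : RatFunc (AlgebraicClosure (RatFunc k)) →+* RatFunc (AlgebraicClosure (RatFunc k)))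
    (hτxC : ∀ a : AlgebraicClosure (RatFunc k), τx (RatFunc.C a) = RatFunc.C a)
    (hτxX : τx RatFunc.X = RatFunc.X + 1) :
    (∃ (N : ℕ) (a : Fin (N + 1) → RatFunc k), a ≠ 0 ∧
      ∃ g ∈ Set.range ι,
        ∑ ℓ : Fin (N + 1),
          RatFunc.C (algebraMap (RatFunc k) (AlgebraicClosure (RatFunc k)) (a ℓ)) *
            (⇑St)^[ℓ.val] f = τx g - g) ↔
      ∀ i : Fin m, ∃ (r : ℚ) (c : k),
        β i = (r : AlgebraicClosure (RatFunc k)) *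
            algebraMap (RatFunc k) (AlgebraicClosure (RatFunc k)) RatFunc.X +
          algebraMap (RatFunc k) (AlgebraicClosure (RatFunc k)) (RatFunc.C c) := by
  have hchar : CharZero (AlgebraicClosure (RatFunc k)) :=
    charZero_of_injective_algebraMap
      ((algebraMap (RatFunc k) (AlgebraicClosure (RatFunc k))).comp RatFunc.C).injective
  have hsk (l : ℕ) (c : k) :
      (σ ^ l) (algebraMap (RatFunc k) (AlgebraicClosure (RatFunc k)) (RatFunc.C c)) =
        algebraMap (RatFunc k) (AlgebraicClosure (RatFunc k)) (RatFunc.C c) := by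
    induction l with
    | zero => simp
    | succ l ih => rw [pow_succ, RingAut.mul_apply, hσk, ih]
  have hst (l : ℕ) :
      (σ ^ l) (algebraMap (RatFunc k) (AlgebraicClosure (RatFunc k)) RatFunc.X) =
        algebraMap (RatFunc k) (AlgebraicClosure (RatFunc k)) RatFunc.X + l := by
    induction l with
    | zero => simp
    | succ l ih =>
      rw [pow_succ, RingAut.mul_apply, hσt, map_add, map_one, ih]
      push_cast
      ring
  simp_rw [hfdef, RatFunc.iterate_coeff_map n α β σ St hStC hStX]
  constructor
  · rintro ⟨N, a, ha, g, -, hg⟩ i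
    obtain ⟨l, hl, z, hz⟩ := RatFunc.exists_period_of_telescoper n α β hn hα hβ σ τx hτxC hτxX N
      (fun e => algebraMap (RatFunc k) (AlgebraicClosure (RatFunc k)) (a e)) (fun h0 => ha (by
        funext e
        simpa using congrFun h0 e)) g hg i
    have hl' : (l : AlgebraicClosure (RatFunc k)) ≠ 0 := Nat.cast_ne_zero.mpr hl
    obtain ⟨c, hc⟩ := exists_const_of_fixed (σ ^ l) (hsk l) l hl (hst l)
      (β i - ((z / l : ℚ) : AlgebraicClosure (RatFunc k)) *
        algebraMap (RatFunc k) (AlgebraicClosure (RatFunc k)) RatFunc.X) (by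
        rw [map_sub, map_mul, map_ratCast, hz, hst]
        push_cast
        field_simp
        ring)
    exact ⟨z / l, c, by rw [← hc]; ring⟩
  · intro h
    choose r c hrc using h
    have hβK (i : Fin m) :
        β i ∈ Set.range (algebraMap (RatFunc k) (AlgebraicClosure (RatFunc k))) :=
      ⟨(r i : RatFunc k) * RatFunc.X + RatFunc.C (c i), by rw [hrc]; simp⟩
    have hσpoly (p : Polynomial k) : σ (algebraMap (RatFunc k) (AlgebraicClosure (RatFunc k))
        (algebraMap (Polynomial k) (RatFunc k) p)) ∈
          (algebraMap (RatFunc k) (AlgebraicClosure (RatFunc k))).fieldRange := by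
      induction p using Polynomial.induction_on' with
      | add p q hp hq => simpa only [map_add] using add_mem hp hq
      | monomial d b =>
        rw [← Polynomial.C_mul_X_pow_eq_monomial, map_mul, map_mul, map_mul, map_pow, map_pow,
          map_pow, RatFunc.algebraMap_C, RatFunc.algebraMap_X, hσk, hσt]
        exact mul_mem (RingHom.mem_fieldRange_self _ _)
          (pow_mem (add_mem (RingHom.mem_fieldRange_self _ _) (one_mem _)) d)
    have hσ (v : RatFunc k) :
        σ (algebraMap (RatFunc k) (AlgebraicClosure (RatFunc k)) v) ∈
          Set.range (algebraMap (RatFunc k) (AlgebraicClosure (RatFunc k))) := by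
      rw [← RatFunc.num_div_denom v, map_div₀, map_div₀]
      exact div_mem (hσpoly _) (hσpoly _)
    have hβinj : Function.Injective β := fun i i' hii => by
      by_contra hne
      exact hβ i i' hne 0 (by simpa using hii)
    have hαK := RatFunc.mem_range_algebraMap_of_mem_range ι hιC hιX n α β hβinj hβK
      (hfdef ▸ hf)
    have hq : ∏ i, (r i).den ≠ 0 := Finset.prod_ne_zero_iff.mpr fun i _ => (r i).den_ne_zero
    have hint (i : Fin m) : ∃ z : ℤ, r i * (∏ i, (r i).den : ℕ) = z := by
      obtain ⟨d, hd⟩ := Finset.dvd_prod_of_mem (fun i => (r i).den) (Finset.mem_univ i)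
      refine ⟨(r i).num * d, ?_⟩
      rw [hd]
      push_cast
      rw [← mul_assoc, Rat.mul_den_eq_num]
    choose z hz using hint
    refine RatFunc.exists_telescoper ι hιC hιX τx hτxC hτxX n α β hαK hβK σ hσ _ hq z fun i => ?_
    have hzi := congrArg (fun x : ℚ => (x : AlgebraicClosure (RatFunc k))) (hz i)
    simp only [Rat.cast_mul, Rat.cast_natCast, Rat.cast_intCast] at hzi
    rw [hrc, map_add, map_mul, map_ratCast, hst, hsk, ← hzi]
    ring
end
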